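/- arXiv:2406.03427 — 4 statements merged into one kernel-verified Lean document; each statement's English description precedes it below -/
import Mathlib

section
/- Let X be a random vector in ℝⁿ with 0 < E|X − EX|² < ∞ and let Y be any random element defined on the same probability space. Then sup_f Var(E[f(X) | Y]) ≥ 1 − mmse(X|Y) / E|X − EX|², where the supremum runs over all measurable f : ℝⁿ → ℝ with E f(X) = 0 and Var(f(X)) = 1, and mmse(X|Y) = E|X − E[X|Y]|². Consequently the squared Hirschfeld–Gebelein–Rényi maximal correlation satisfies S²(X,Y) ≥ 1 − mmse(X|Y)/E|X − EX|². -/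
open MeasureTheory ProbabilityTheory Real
open scoped ENNReal NNReal

noncomputable section

lemma condExp_euclideanSpace_apply {Ω ι : Type*} [Fintype ι] {m m₀ : MeasurableSpace Ω}
    {P : Measure Ω} {X : Ω → EuclideanSpace ℝ ι}
    (hX : Integrable X P) (i : ι) :
    (fun ω => (P[X | m]) ω i) =ᵐ[P] P[fun ω => X ω i | m] :=
  (EuclideanSpace.proj (𝕜 := ℝ) i).comp_condExp_comm hX

section Lemmas

variable {Ω : Type*} {m m₀ : MeasurableSpace Ω} {P : Measure Ω} [IsProbabilityMeasure P]

/-- Law of total variance, with the mean-square error in place of the conditional variance. -/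
lemma integral_sub_condExp_sq_add_variance_condExp (hm : m ≤ m₀) {Z : Ω → ℝ}
    (hZ : MemLp Z 2 P) :
    ∫ ω, (Z ω - (P[Z | m]) ω) ^ 2 ∂P + variance (P[Z | m]) P = variance Z P := by
  rw [← integral_condVar_add_variance_condExp hm hZ, condVar, integral_condExp hm]
  rfl

lemma variance_condExp_le (hm : m ≤ m₀) {Z : Ω → ℝ} (hZ : MemLp Z 2 P) :
    variance (P[Z | m]) P ≤ variance Z P := by
  rw [← integral_sub_condExp_sq_add_variance_condExp hm hZ]
  exact le_add_of_nonneg_left (integral_nonneg fun _ => sq_nonneg _)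

lemma variance_condExp_const_mul_sub (hm : m ≤ m₀) {Z : Ω → ℝ} (hZ : Integrable Z P) (c a : ℝ) :
    variance (P[fun ω => c * (Z ω - a) | m]) P = c ^ 2 * variance (P[Z | m]) P := by
  have h : P[fun ω => c * (Z ω - a) | m] =ᵐ[P] fun ω => c * ((P[Z | m]) ω - a) := by
    have h₁ : P[fun ω => c * (Z ω - a) | m] =ᵐ[P] c • P[Z - fun _ => a | m] :=
      condExp_smul c (Z - fun _ => a) m
    filter_upwards [h₁, condExp_sub hZ (integrable_const a) m] with ω h₂ h₃
    rw [h₂, Pi.smul_apply, h₃, condExp_const hm]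
    simp
  rw [variance_congr h, variance_const_mul,
    variance_sub_const integrable_condExp.aestronglyMeasurable]

/-- The supremum over standardized functions of `X` of the variance of the conditional expectation
bounds the ratio for every square-integrable real function of `X`. -/
lemma variance_condExp_le_sSup_mul_variance {E : Type*} [MeasurableSpace E] (hm : m ≤ m₀)
    {X : Ω → E} (hX : Measurable X) {g : E → ℝ} (hg : Measurable g)
    (hgX : MemLp (fun ω => g (X ω)) 2 P) :
    variance (P[fun ω => g (X ω) | m]) P ≤
      sSup {r : ℝ | ∃ f : E → ℝ, Measurable f ∧ (∫ ω, f (X ω) ∂P) = 0 ∧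
        variance (fun ω => f (X ω)) P = 1 ∧ r = variance (P[fun ω => f (X ω) | m]) P} *
      variance (fun ω => g (X ω)) P := by
  have hint : Integrable (fun ω => g (X ω)) P := hgX.integrable one_le_two
  rcases (variance_nonneg (fun ω => g (X ω)) P).eq_or_lt with h0 | hv
  · rw [← h0, mul_zero, h0]
    exact variance_condExp_le hm hgX
  set v := variance (fun ω => g (X ω)) P
  set a := ∫ ω, g (X ω) ∂P with ha
  have hc : (√v)⁻¹ ^ 2 = v⁻¹ := by rw [inv_pow, Real.sq_sqrt hv.le]
  rw [← div_le_iff₀ hv]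
  refine le_csSup ⟨1, ?_⟩ ⟨fun x => (√v)⁻¹ * (g x - a), by fun_prop, ?_, ?_, ?_⟩
  · rintro r ⟨f, hf, -, hvar, rfl⟩
    rw [← hvar]
    exact variance_condExp_le hm (memLp_two_of_variance_ne_zero
      (hf.comp hX).aestronglyMeasurable (hvar ▸ one_ne_zero))
  · rw [integral_const_mul, integral_sub hint (integrable_const a)]
    simp [ha]
  · rw [variance_const_mul, variance_sub_const hint.aestronglyMeasurable, hc]
    exact inv_mul_cancel₀ hv.ne'
  · rw [variance_condExp_const_mul_sub hm hint, hc, div_eq_inv_mul]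

lemma integral_norm_sub_integral_sq {ι : Type*} [Fintype ι] {X : Ω → EuclideanSpace ℝ ι}
    (hX : MemLp X 2 P) :
    ∫ ω, ‖X ω - ∫ ω', X ω' ∂P‖ ^ 2 ∂P = ∑ i, variance (fun ω => X ω i) P := by
  have hcoord (i : ι) : MemLp (fun ω => X ω i) 2 P :=
    (EuclideanSpace.proj (𝕜 := ℝ) i).comp_memLp' hX
  have hmean (i : ι) : (∫ ω, X ω ∂P) i = ∫ ω, X ω i ∂P :=
    ((EuclideanSpace.proj (𝕜 := ℝ) i).integral_comp_comm (hX.integrable one_le_two)).symm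
  simp_rw [EuclideanSpace.real_norm_sq_eq, PiLp.sub_apply, hmean]
  have hsq (i : ι) : Integrable (fun ω => (X ω i - ∫ ω', X ω' i ∂P) ^ 2) P :=
    ((hcoord i).sub (memLp_const _)).integrable_sq
  rw [integral_finsetSum _ fun i _ => hsq i]
  exact Finset.sum_congr rfl fun i _ =>
    (variance_eq_integral (hcoord i).aestronglyMeasurable.aemeasurable).symm

lemma integral_norm_sub_condExp_sq {ι : Type*} [Fintype ι] (hm : m ≤ m₀)
    {X : Ω → EuclideanSpace ℝ ι} (hX : MemLp X 2 P) :
    ∫ ω, ‖X ω - (P[X | m]) ω‖ ^ 2 ∂P =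
      ∑ i, (variance (fun ω => X ω i) P - variance (P[fun ω => X ω i | m]) P) := by
  have hcoord (i : ι) : MemLp (fun ω => X ω i) 2 P :=
    (EuclideanSpace.proj (𝕜 := ℝ) i).comp_memLp' hX
  have hae : (fun ω => ‖X ω - (P[X | m]) ω‖ ^ 2) =ᵐ[P]
      fun ω => ∑ i, (X ω i - (P[fun ω => X ω i | m]) ω) ^ 2 := by
    filter_upwards [ae_all_iff.2 fun i =>
      condExp_euclideanSpace_apply (m := m) (hX.integrable one_le_two) i] with ω hω
    simp_rw [EuclideanSpace.real_norm_sq_eq, PiLp.sub_apply, hω]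
  have hsq (i : ι) : Integrable (fun ω => (X ω i - (P[fun ω => X ω i | m]) ω) ^ 2) P :=
    ((hcoord i).sub ((hcoord i).condExp one_le_two)).integrable_sq
  rw [integral_congr_ae hae, integral_finsetSum _ fun i _ => hsq i]
  exact Finset.sum_congr rfl fun i _ =>
    eq_sub_of_add_eq (integral_sub_condExp_sq_add_variance_condExp hm (hcoord i))

end Lemmas

/-- Lower bound on the (squared) maximal correlation
`S²(X,Y) = sup_f Var(E[f(X)|Y])` in terms of the MMSE:
`S²(X,Y) ≥ 1 − mmse(X|Y)/E|X−EX|²`. -/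
theorem stmt1 {n : ℕ} {Ω β : Type*} [MeasurableSpace Ω] [MeasurableSpace β]
    (P : Measure Ω) [IsProbabilityMeasure P]
    (X : Ω → EuclideanSpace ℝ (Fin n)) (Y : Ω → β)
    (hX : Measurable X) (hY : Measurable Y)
    (hmom : Integrable (fun ω => ‖X ω - ∫ ω', X ω' ∂P‖ ^ 2) P)
    (hpos : 0 < ∫ ω, ‖X ω - ∫ ω', X ω' ∂P‖ ^ 2 ∂P) :
    1 - (∫ ω, ‖X ω - (P[X | MeasurableSpace.comap Y inferInstance]) ω‖ ^ 2 ∂P) /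
        (∫ ω, ‖X ω - ∫ ω', X ω' ∂P‖ ^ 2 ∂P) ≤
      sSup {r : ℝ | ∃ f : EuclideanSpace ℝ (Fin n) → ℝ, Measurable f ∧
        (∫ ω, f (X ω) ∂P) = 0 ∧ variance (fun ω => f (X ω)) P = 1 ∧
        r = variance (P[(fun ω => f (X ω)) | MeasurableSpace.comap Y inferInstance]) P} := by
  have hm := hY.comap_le
  have hmem : MemLp X 2 P := by
    have h : MemLp (fun ω => X ω - ∫ ω', X ω' ∂P) 2 P :=
      (memLp_two_iff_integrable_sq_norm (hX.sub_const _).aestronglyMeasurable).2 hmom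
    have hsum := h.add (memLp_const (∫ ω', X ω' ∂P))
    exact hsum.ae_eq (.of_forall fun ω => sub_add_cancel _ _)
  rw [one_sub_div hpos.ne', div_le_iff₀ hpos, integral_norm_sub_condExp_sq hm hmem,
    integral_norm_sub_integral_sq hmem, ← Finset.sum_sub_distrib, Finset.mul_sum]
  refine Finset.sum_le_sum fun i _ => ?_
  rw [sub_sub_cancel]
  exact variance_condExp_le_sSup_mul_variance hm hX (g := fun x => x i) (by fun_prop)
    ((EuclideanSpace.proj (𝕜 := ℝ) i).comp_memLp' hmem)
end
end

section
/- Let μ and ν be probability measures on ℝⁿ with D(ν‖μ) < ∞ and ∫|x|⁴ dμ(x) < ∞. For s > 0 let μ_s and ν_s be their evolutions under the heat flow, and let f_s = dν_s/dμ_s (the ratio of the Gaussian-convolved densities, a smooth positive function). Then for every s > 0, the map t ↦ D(ν_t‖μ_t) is differentiable at s with derivative d/ds D(ν_s‖μ_s) = −(1/2)·J(ν_s‖μ_s), where J(ν_s‖μ_s) = ∫ |∇f_s|²/f_s dμ_s is the relative Fisher information. -/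
open MeasureTheory ProbabilityTheory Real
open scoped ENNReal NNReal

noncomputable section

/-- Standard Gaussian measure on ℝⁿ. -/
def stdGaussian (n : ℕ) : Measure (EuclideanSpace ℝ (Fin n)) :=
  volume.withDensity
    (fun x => ENNReal.ofReal ((2 * π) ^ (-(n : ℝ) / 2) * Real.exp (-‖x‖ ^ 2 / 2)))

/-- Heat-flow evolution `μ_s`: the law of `X + √s Z`. -/
def heatFlow {n : ℕ} (μ : Measure (EuclideanSpace ℝ (Fin n))) (s : ℝ) :
    Measure (EuclideanSpace ℝ (Fin n)) :=
  (μ.prod (stdGaussian n)).map (fun p => p.1 + Real.sqrt s • p.2)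

/-- Density of the centered Gaussian on ℝⁿ with covariance `s·Id`. -/
def gaussDensity (n : ℕ) (s : ℝ) (x : EuclideanSpace ℝ (Fin n)) : ℝ :=
  (2 * π * s) ^ (-(n : ℝ) / 2) * Real.exp (-‖x‖ ^ 2 / (2 * s))

/-- Density of `μ_s = μ * γ_s` (the Gaussian-convolved density). -/
def heatDensity {n : ℕ} (μ : Measure (EuclideanSpace ℝ (Fin n))) (s : ℝ)
    (y : EuclideanSpace ℝ (Fin n)) : ℝ :=
  ∫ x, gaussDensity n s (y - x) ∂μ

/-- `f_s = dν_s/dμ_s`, the ratio of Gaussian-convolved densities. -/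
def heatRatio {n : ℕ} (ν μ : Measure (EuclideanSpace ℝ (Fin n))) (s : ℝ)
    (y : EuclideanSpace ℝ (Fin n)) : ℝ :=
  heatDensity ν s y / heatDensity μ s y

/-- Kullback–Leibler divergence `D(ν‖μ) = ∫ log (dν/dμ) dν`. -/
def klDiv {α : Type*} [MeasurableSpace α] (ν μ : Measure α) : ℝ :=
  ∫ x, Real.log (ν.rnDeriv μ x).toReal ∂ν

namespace HeatKL

variable {n : ℕ}

local notation "𝔼" => EuclideanSpace ℝ (Fin n)

/-- The unnormalised Gaussian kernel. -/
def ker (t : ℝ) (z : EuclideanSpace ℝ (Fin n)) : ℝ := Real.exp (-‖z‖ ^ 2 / (2 * t))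

/-- The convolution of a function with a measure. -/
def smooth (φ : EuclideanSpace ℝ (Fin n) → ℝ) (μ : Measure (EuclideanSpace ℝ (Fin n)))
    (y : EuclideanSpace ℝ (Fin n)) : ℝ := ∫ x, φ (y - x) ∂μ

/-- The Gaussian kernel weighted by the squared norm. -/
def kerSq (t : ℝ) (z : EuclideanSpace ℝ (Fin n)) : ℝ := ‖z‖ ^ 2 * ker t z

/-- The Gaussian kernel weighted by a linear form. -/
def kerLin (t : ℝ) (v z : EuclideanSpace ℝ (Fin n)) : ℝ := inner ℝ v z * ker t z

/-- The Gaussian kernel weighted by the square of a linear form. -/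
def kerLinSq (t : ℝ) (v z : EuclideanSpace ℝ (Fin n)) : ℝ := inner ℝ v z ^ 2 * ker t z

lemma ker_pos (t : ℝ) (z : 𝔼) : 0 < ker t z := Real.exp_pos _

lemma ker_le_one {t : ℝ} (ht : 0 < t) (z : 𝔼) : ker t z ≤ 1 := by
  refine Real.exp_le_one_iff.2 (div_nonpos_of_nonpos_of_nonneg ?_ (by positivity))
  have := sq_nonneg ‖z‖
  linarith

lemma abs_ker_le_one {t : ℝ} (ht : 0 < t) (z : 𝔼) : |ker t z| ≤ 1 := by
  rw [abs_of_pos (ker_pos t z)]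
  exact ker_le_one ht z

lemma ker_mono {a t : ℝ} (ha : 0 < a) (hat : a ≤ t) (z : 𝔼) : ker a z ≤ ker t z := by
  refine Real.exp_le_exp.2 ?_
  rw [neg_div, neg_div, neg_le_neg_iff]
  gcongr

lemma continuous_ker (t : ℝ) : Continuous (ker t : 𝔼 → ℝ) := by unfold ker; fun_prop

lemma continuous_kerSq (t : ℝ) : Continuous (kerSq t : 𝔼 → ℝ) := by
  unfold kerSq ker; fun_prop

lemma continuous_kerLin (t : ℝ) (v : 𝔼) : Continuous (kerLin t v) := by
  unfold kerLin ker; fun_prop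

lemma continuous_kerLinSq (t : ℝ) (v : 𝔼) : Continuous (kerLinSq t v) := by
  unfold kerLinSq ker; fun_prop

lemma kerSq_nonneg (t : ℝ) (z : 𝔼) : 0 ≤ kerSq t z := mul_nonneg (sq_nonneg _) (ker_pos t z).le

lemma kerLinSq_nonneg (t : ℝ) (v z : 𝔼) : 0 ≤ kerLinSq t v z :=
  mul_nonneg (sq_nonneg _) (ker_pos t z).le

lemma kerSq_le {t : ℝ} (ht : 0 < t) (z : 𝔼) : kerSq t z ≤ 2 * t := by
  have h := Real.add_one_le_exp (‖z‖ ^ 2 / (2 * t))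
  have h1 : ker t z * Real.exp (‖z‖ ^ 2 / (2 * t)) = 1 := by
    rw [ker, ← Real.exp_add, neg_div, neg_add_cancel, Real.exp_zero]
  have h2 : ‖z‖ ^ 2 = 2 * t * (‖z‖ ^ 2 / (2 * t)) := by field_simp
  have h3 : ker t z * (‖z‖ ^ 2 / (2 * t)) ≤ 1 := by
    nlinarith [ker_pos t z]
  calc kerSq t z = 2 * t * (ker t z * (‖z‖ ^ 2 / (2 * t))) := by
        rw [kerSq]; nth_rewrite 1 [h2]; ring
    _ ≤ 2 * t * 1 := by gcongr
    _ = 2 * t := mul_one _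

lemma abs_kerSq_le {t : ℝ} (ht : 0 < t) (z : 𝔼) : |kerSq t z| ≤ 2 * t := by
  rw [abs_of_nonneg (kerSq_nonneg t z)]
  exact kerSq_le ht z

lemma kerLinSq_le_kerSq (t : ℝ) {v : 𝔼} (hv : ‖v‖ = 1) (z : 𝔼) :
    kerLinSq t v z ≤ kerSq t z := by
  have h := abs_real_inner_le_norm v z
  rw [hv, one_mul] at h
  exact mul_le_mul_of_nonneg_right (sq_le_sq' (abs_le.1 h).1 (abs_le.1 h).2) (ker_pos t z).le

lemma abs_kerLinSq_le {t : ℝ} (ht : 0 < t) {v : 𝔼} (hv : ‖v‖ = 1) (z : 𝔼) :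
    |kerLinSq t v z| ≤ 2 * t := by
  rw [abs_of_nonneg (kerLinSq_nonneg t v z)]
  exact (kerLinSq_le_kerSq t hv z).trans (kerSq_le ht z)

lemma abs_kerLin_le (t : ℝ) {v : 𝔼} (hv : ‖v‖ = 1) (z : 𝔼) :
    |kerLin t v z| ≤ ker t z + kerSq t z := by
  have h := abs_real_inner_le_norm v z
  rw [hv, one_mul] at h
  rw [kerLin, kerSq, abs_mul, abs_of_pos (ker_pos t z)]
  nlinarith [ker_pos t z, sq_nonneg (‖z‖ - 1), norm_nonneg z]

lemma abs_kerLin_le_const {t : ℝ} (ht : 0 < t) {v : 𝔼} (hv : ‖v‖ = 1) (z : 𝔼) :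
    |kerLin t v z| ≤ 1 + 2 * t :=
  (abs_kerLin_le t hv z).trans (add_le_add (ker_le_one ht z) (kerSq_le ht z))

section Smooth

variable {μ : Measure (EuclideanSpace ℝ (Fin n))}

lemma integrable_comp_sub [IsFiniteMeasure μ] {φ : 𝔼 → ℝ} (hφ : Continuous φ) {C : ℝ}
    (hC : ∀ z, |φ z| ≤ C) (y : 𝔼) : Integrable (fun x => φ (y - x)) μ :=
  Integrable.of_bound (by fun_prop) C (Filter.Eventually.of_forall fun x => hC _)

lemma continuous_smooth [IsFiniteMeasure μ] {φ : 𝔼 → ℝ} (hφ : Continuous φ) {C : ℝ}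
    (hC : ∀ z, |φ z| ≤ C) : Continuous (smooth φ μ) :=
  continuous_of_dominated (bound := fun _ => C) (fun y => by fun_prop)
    (fun y => Filter.Eventually.of_forall fun x => hC _) (integrable_const C)
    (Filter.Eventually.of_forall fun x => by fun_prop)

lemma hasFDerivAt_smooth [IsFiniteMeasure μ] {φ : 𝔼 → ℝ} {φ' : 𝔼 → 𝔼 →L[ℝ] ℝ}
    {C C' : ℝ} (hC : ∀ z, |φ z| ≤ C) (hC' : ∀ z, ‖φ' z‖ ≤ C')
    (hφ' : Continuous φ') (h : ∀ z, HasFDerivAt φ (φ' z) z) (y : 𝔼) :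
    HasFDerivAt (smooth φ μ) (∫ x, φ' (y - x) ∂μ) y := by
  have hφ : Continuous φ := continuous_iff_continuousAt.2 fun z => (h z).continuousAt
  refine hasFDerivAt_integral_of_dominated_of_fderiv_le (s := Set.univ)
    (F' := fun y x => φ' (y - x)) (bound := fun _ => C') Filter.univ_mem
    (Filter.Eventually.of_forall fun y => by fun_prop)
    (integrable_comp_sub hφ hC y) (by fun_prop) (Filter.Eventually.of_forall fun x y _ => hC' _)
    (integrable_const _) (Filter.Eventually.of_forall fun x y _ => ?_)
  simpa [Function.comp_def] using (h (y - x)).comp y ((hasFDerivAt_id y).sub_const x)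

lemma exists_hasFDerivAt_smooth [IsFiniteMeasure μ] {φ : 𝔼 → ℝ} {φ' : 𝔼 → 𝔼 →L[ℝ] ℝ}
    {C C' : ℝ} (hC : ∀ z, |φ z| ≤ C) (hC' : ∀ z, ‖φ' z‖ ≤ C')
    (hφ' : Continuous φ') (h : ∀ z, HasFDerivAt φ (φ' z) z) (y : 𝔼) :
    ∃ T : 𝔼 →L[ℝ] ℝ, HasFDerivAt (smooth φ μ) T y ∧ ∀ v, T v = smooth (fun z => φ' z v) μ y := by
  refine ⟨_, hasFDerivAt_smooth hC hC' hφ' h y, fun v => ?_⟩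
  rw [ContinuousLinearMap.integral_apply]
  · rfl
  · exact Integrable.of_bound (by fun_prop) C' (Filter.Eventually.of_forall fun x => hC' _)

lemma hasFDerivAt_ker (t : ℝ) (z : 𝔼) :
    HasFDerivAt (ker t) (-(ker t z / t) • innerSL ℝ z) z := by
  have h := (((hasStrictFDerivAt_norm_sq z).hasFDerivAt.neg).mul_const (2 * t)⁻¹).exp
  have h2 : (fun x : 𝔼 => Real.exp ((-fun x : 𝔼 => ‖x‖ ^ 2) x * (2 * t)⁻¹)) = ker t := by
    ext x; simp [ker, div_eq_mul_inv]
  rw [h2] at h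
  refine h.congr_fderiv ?_
  ext w
  simp [ker, div_eq_mul_inv]
  ring

lemma norm_hasFDerivAt_ker_le {t : ℝ} (ht : 0 < t) (z : 𝔼) :
    ‖-(ker t z / t) • innerSL ℝ z‖ ≤ (1 + 2 * t) / t := by
  rw [norm_smul, innerSL_apply_norm, norm_neg, Real.norm_eq_abs,
    abs_of_pos (div_pos (ker_pos t z) ht), div_mul_eq_mul_div]
  gcongr
  have h1 := ker_le_one ht z
  have h2 := kerSq_le ht z
  rw [kerSq] at h2
  nlinarith [ker_pos t z, sq_nonneg (‖z‖ - 1), norm_nonneg z]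

lemma exists_hasFDerivAt_smooth_ker [IsFiniteMeasure μ] {t : ℝ} (ht : 0 < t) (y : 𝔼) :
    ∃ T : 𝔼 →L[ℝ] ℝ, HasFDerivAt (smooth (ker t) μ) T y ∧
      ∀ v, T v = -(smooth (kerLin t v) μ y) / t := by
  obtain ⟨T, hT, hTv⟩ := exists_hasFDerivAt_smooth (μ := μ) (abs_ker_le_one ht)
    (norm_hasFDerivAt_ker_le ht) (by have := continuous_ker (n := n) t; fun_prop)
    (hasFDerivAt_ker t) y
  refine ⟨T, hT, fun v => ?_⟩
  rw [hTv, smooth, smooth, ← integral_neg, ← integral_div]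
  congr 1
  ext x
  simp only [kerLin, smul_apply, innerSL_apply_apply, smul_eq_mul, real_inner_comm]
  ring

lemma hasLineDerivAt_smooth_ker [IsFiniteMeasure μ] {t : ℝ} (ht : 0 < t) (v y : 𝔼) :
    HasLineDerivAt ℝ (smooth (ker t) μ) (-(smooth (kerLin t v) μ y) / t) y v := by
  obtain ⟨T, hT, hTv⟩ := exists_hasFDerivAt_smooth_ker (μ := μ) ht y
  rw [← hTv]
  exact hT.hasLineDerivAt v

lemma hasLineDerivAt_smooth_kerLin [IsFiniteMeasure μ] {t : ℝ} (ht : 0 < t) {v : 𝔼}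
    (hv : ‖v‖ = 1) (y : 𝔼) :
    HasLineDerivAt ℝ (smooth (kerLin t v) μ)
      (smooth (ker t) μ y - smooth (kerLinSq t v) μ y / t) y v := by
  have hd (z : 𝔼) : HasFDerivAt (kerLin t v)
      (inner ℝ v z • (-(ker t z / t) • innerSL ℝ z) + ker t z • innerSL ℝ v) z :=
    (innerSL ℝ v).hasFDerivAt.mul (hasFDerivAt_ker t z)
  obtain ⟨T, hT, hTv⟩ := exists_hasFDerivAt_smooth (μ := μ) (C' := 2 * t / t + 1)
    (abs_kerLin_le_const ht hv)
    (fun z => by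
      refine (norm_add_le _ _).trans (add_le_add ?_ ?_)
      · rw [norm_smul, norm_smul, innerSL_apply_norm, norm_neg, Real.norm_eq_abs, Real.norm_eq_abs,
          abs_of_pos (div_pos (ker_pos t z) ht)]
        have h := abs_real_inner_le_norm v z
        rw [hv, one_mul] at h
        have h2 := kerSq_le ht z
        have h3 := ker_pos t z
        calc _ ≤ ‖z‖ * (ker t z / t * ‖z‖) := by gcongr
          _ = kerSq t z / t := by rw [kerSq]; ring
          _ ≤ _ := by gcongr
      · rw [norm_smul, innerSL_apply_norm, hv, mul_one]
        exact abs_ker_le_one ht z)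
    (by have := continuous_ker (n := n) t; fun_prop) hd y
  suffices h : smooth (ker t) μ y - smooth (kerLinSq t v) μ y / t = T v by
    rw [h]
    exact hT.hasLineDerivAt v
  rw [hTv, smooth, smooth, smooth, ← integral_div, ← integral_sub]
  · congr 1
    ext x
    simp only [kerLinSq, smul_apply, add_apply, innerSL_apply_apply, smul_eq_mul,
      real_inner_self_eq_norm_sq, hv, real_inner_comm v]
    ring
  · exact integrable_comp_sub (continuous_ker t) (abs_ker_le_one ht) y
  · exact (integrable_comp_sub (continuous_kerLinSq t v) (abs_kerLinSq_le ht hv) y).div_const _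

lemma hasDerivAt_smooth_ker [IsFiniteMeasure μ] {s : ℝ} (hs : 0 < s) (y : 𝔼) :
    HasDerivAt (fun t => smooth (ker t) μ y) (smooth (kerSq s) μ y / (2 * s ^ 2)) s := by
  have key := hasDerivAt_integral_of_dominated_loc_of_deriv_le (μ := μ)
    (F := fun t x => ker t (y - x)) (F' := fun t x => kerSq t (y - x) / (2 * t ^ 2))
    (bound := fun _ => 2 / s) (x₀ := s) (s := Set.Ioi (s / 2)) (Ioi_mem_nhds (by linarith))
    (Filter.Eventually.of_forall fun t => by have := continuous_ker (n := n) t; fun_prop)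
    (integrable_comp_sub (continuous_ker s) (abs_ker_le_one hs) y)
    (by have := continuous_kerSq (n := n) s; fun_prop)
    (Filter.Eventually.of_forall fun x t ht => by
      have hts : s / 2 < t := ht
      have ht : 0 < t := by linarith
      rw [Real.norm_eq_abs, abs_of_nonneg (div_nonneg (kerSq_nonneg _ _) (by positivity))]
      calc kerSq t (y - x) / (2 * t ^ 2) ≤ 2 * t / (2 * t ^ 2) := by
            gcongr; exact kerSq_le ht _
        _ = 1 / t := by field_simp
        _ ≤ 2 / s := by rw [div_le_div_iff₀ ht hs]; linarith)
    (integrable_const _)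
    (Filter.Eventually.of_forall fun x t ht => by
      have hts : s / 2 < t := ht
      have ht : 0 < t := by linarith
      have h := ((((hasDerivAt_id t).const_mul 2).inv (by simp [ht.ne'])).const_mul
        (-‖y - x‖ ^ 2)).exp
      refine h.congr_deriv ?_
      simp [kerSq, ker, div_eq_mul_inv]
      field_simp)
  refine key.2.congr_deriv ?_
  rw [smooth, ← integral_div]

end Smooth

section Bounds

variable {μ ν : Measure (EuclideanSpace ℝ (Fin n))}

lemma integrable_ker {t : ℝ} (ht : 0 < t) : Integrable (ker t : 𝔼 → ℝ) := by
  have h := (GaussianFourier.integrable_cexp_neg_mul_sq_norm_add (V := 𝔼)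
    (b := ((1 / (2 * t) : ℝ) : ℂ)) (by rw [Complex.ofReal_re]; positivity) 0 0).re
  convert h using 1
  ext z
  have : (-((1 / (2 * t) : ℝ) : ℂ) * (‖z‖ : ℂ) ^ 2 + 0 * (inner ℝ (0 : 𝔼) z : ℝ)) =
      ((-‖z‖ ^ 2 / (2 * t) : ℝ) : ℂ) := by
    push_cast; ring
  rw [this, ← Complex.ofReal_exp]
  rfl

lemma integrable_convolution_mul [IsFiniteMeasure μ] {φ h : 𝔼 → ℝ} (hφ : Integrable φ)
    (hh : Integrable h μ) : Integrable fun y => ∫ x, h x * φ (y - x) ∂μ :=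
  (hh.convolution_integrand (ContinuousLinearMap.mul ℝ ℝ) hφ).integral_prod_left

lemma integrable_smooth_ker [IsFiniteMeasure μ] {t : ℝ} (ht : 0 < t) :
    Integrable (smooth (ker t) μ) := by
  simpa [smooth, Function.comp_def, funext_iff] using!
    integrable_convolution_mul (integrable_ker ht) (integrable_const (1 : ℝ))

lemma smooth_kerSq_nonneg (t : ℝ) (y : 𝔼) : 0 ≤ smooth (kerSq t) μ y :=
  integral_nonneg fun _ => kerSq_nonneg t _

lemma smooth_kerLinSq_nonneg (t : ℝ) (v y : 𝔼) : 0 ≤ smooth (kerLinSq t v) μ y :=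
  integral_nonneg fun _ => kerLinSq_nonneg t v _

variable [IsProbabilityMeasure μ] [IsProbabilityMeasure ν]

lemma integrable_ker_sub {t : ℝ} (ht : 0 < t) (y : 𝔼) : Integrable (fun x => ker t (y - x)) μ :=
  integrable_comp_sub (continuous_ker t) (abs_ker_le_one ht) y

lemma integrable_kerSq_sub {t : ℝ} (ht : 0 < t) (y : 𝔼) :
    Integrable (fun x => kerSq t (y - x)) μ :=
  integrable_comp_sub (continuous_kerSq t) (abs_kerSq_le ht) y

lemma smooth_ker_pos {t : ℝ} (ht : 0 < t) (y : 𝔼) : 0 < smooth (ker t) μ y :=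
  integral_exp_pos (integrable_ker_sub ht y)

lemma smooth_ker_mono {a t : ℝ} (ha : 0 < a) (hat : a ≤ t) (y : 𝔼) :
    smooth (ker a) μ y ≤ smooth (ker t) μ y :=
  integral_mono (integrable_ker_sub ha y) (integrable_ker_sub (ha.trans_le hat) y)
    fun _ => ker_mono ha hat _

lemma smooth_kerLinSq_le {t : ℝ} (ht : 0 < t) {v : 𝔼} (hv : ‖v‖ = 1) (y : 𝔼) :
    smooth (kerLinSq t v) μ y ≤ smooth (kerSq t) μ y :=
  integral_mono (integrable_comp_sub (continuous_kerLinSq t v) (abs_kerLinSq_le ht hv) y)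
    (integrable_kerSq_sub ht y) fun _ => kerLinSq_le_kerSq t hv _

lemma abs_smooth_kerLin_le {t : ℝ} (ht : 0 < t) {v : 𝔼} (hv : ‖v‖ = 1) (y : 𝔼) :
    |smooth (kerLin t v) μ y| ≤ smooth (ker t) μ y + smooth (kerSq t) μ y := by
  refine (abs_integral_le_integral_abs).trans ?_
  rw [smooth, smooth, ← integral_add (integrable_ker_sub ht y) (integrable_kerSq_sub ht y)]
  exact integral_mono
    (integrable_comp_sub (continuous_kerLin t v) (abs_kerLin_le_const ht hv) y).abs
    ((integrable_ker_sub ht y).add (integrable_kerSq_sub ht y)) fun x => abs_kerLin_le t hv _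

lemma smooth_kerLin_sq_le {t : ℝ} (ht : 0 < t) {v : 𝔼} (hv : ‖v‖ = 1) (y : 𝔼) :
    smooth (kerLin t v) μ y ^ 2 ≤ smooth (ker t) μ y * smooth (kerLinSq t v) μ y := by
  have hP := smooth_ker_pos (μ := μ) ht y
  set P := smooth (ker t) μ y
  set A := smooth (kerLin t v) μ y
  set B := smooth (kerLinSq t v) μ y
  have i1 : Integrable (fun x => kerLinSq t v (y - x)) μ :=
    integrable_comp_sub (continuous_kerLinSq t v) (abs_kerLinSq_le ht hv) y
  have i2 : Integrable (fun x => 2 * (A / P) * kerLin t v (y - x)) μ :=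
    (integrable_comp_sub (continuous_kerLin t v) (abs_kerLin_le_const ht hv) y).const_mul _
  have i3 : Integrable (fun x => (A / P) ^ 2 * ker t (y - x)) μ :=
    (integrable_ker_sub ht y).const_mul _
  have h : 0 ≤ B - 2 * (A / P) * A + (A / P) ^ 2 * P := by
    calc 0 ≤ ∫ x, (inner ℝ v (y - x) - A / P) ^ 2 * ker t (y - x) ∂μ :=
          integral_nonneg fun x => mul_nonneg (sq_nonneg _) (ker_pos _ _).le
      _ = ∫ x, kerLinSq t v (y - x) - 2 * (A / P) * kerLin t v (y - x)
            + (A / P) ^ 2 * ker t (y - x) ∂μ := by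
          congr 1; ext x; simp only [kerLinSq, kerLin]; ring
      _ = _ := by
          refine (integral_add (i1.sub i2) i3).trans ?_
          rw [integral_const_mul]
          refine congrArg (· + (A / P) ^ 2 * P) ((integral_sub i1 i2).trans ?_)
          rw [integral_const_mul]
          rfl
  have h2 : P * (B - 2 * (A / P) * A + (A / P) ^ 2 * P) = P * B - A ^ 2 := by
    field_simp; ring
  nlinarith [mul_nonneg hP.le h]

lemma smooth_kerSq_le {t b : ℝ} (ht : 0 < t) (hb : 0 < b) (y : 𝔼) :
    (1 / (2 * t) - 1 / (2 * b)) * smooth (kerSq t) μ y ≤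
      smooth (ker t) μ y * Real.log (smooth (ker b) μ y / smooth (ker t) μ y) := by
  have hP := smooth_ker_pos (μ := μ) ht y
  have hR := smooth_ker_pos (μ := μ) hb y
  set P := smooth (ker t) μ y
  set R := smooth (ker b) μ y
  set δ := 1 / (2 * t) - 1 / (2 * b)
  have i1 : Integrable (fun x => (1 - Real.log (R / P)) * ker t (y - x)) μ :=
    (integrable_ker_sub ht y).const_mul _
  have i2 : Integrable (fun x => δ * kerSq t (y - x)) μ := (integrable_kerSq_sub ht y).const_mul _
  have key : (1 - Real.log (R / P)) * P + δ * smooth (kerSq t) μ y ≤ P / R * R := by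
    calc _ = ∫ x, (1 - Real.log (R / P)) * ker t (y - x) + δ * kerSq t (y - x) ∂μ := by
          rw [integral_add i1 i2, integral_const_mul, integral_const_mul]; rfl
      _ ≤ ∫ x, P / R * ker b (y - x) ∂μ := by
          refine integral_mono (i1.add i2) ((integrable_ker_sub hb y).const_mul _) fun x => ?_
          have h := Real.add_one_le_exp (δ * ‖y - x‖ ^ 2 - Real.log (R / P))
          have h2 : ker t (y - x) * Real.exp (δ * ‖y - x‖ ^ 2 - Real.log (R / P)) =
              P / R * ker b (y - x) := by
            rw [Real.exp_sub, Real.exp_log (div_pos hR hP), ← mul_div_assoc, ker, ← Real.exp_add,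
              ker, div_eq_mul_inv _ (R / P), inv_div, mul_comm]
            congr 2
            simp only [δ]
            field_simp
            ring
          calc _ = ker t (y - x) * (δ * ‖y - x‖ ^ 2 - Real.log (R / P) + 1) := by
                simp only [kerSq]; ring
            _ ≤ _ := by
                rw [← h2]
                exact mul_le_mul_of_nonneg_left h (ker_pos _ _).le
      _ = _ := by rw [integral_const_mul]; rfl
  rw [div_mul_cancel₀ _ hR.ne'] at key
  linarith

lemma smooth_ker_sq_div_le {a b : ℝ} (ha : 0 < a) (hb : 0 < b) (hab : b < 2 * a) (y : 𝔼) :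
    smooth (ker b) μ y ^ 2 / smooth (ker a) μ y ≤ smooth (ker (1 / (2 / b - 1 / a))) μ y := by
  have hP := smooth_ker_pos (μ := μ) ha y
  set P := smooth (ker a) μ y
  set R := smooth (ker b) μ y
  have hr : 0 < 1 / (2 / b - 1 / a) := by
    refine one_div_pos.2 ?_
    rw [sub_pos, div_lt_div_iff₀ ha hb]
    linarith
  set r := 1 / (2 / b - 1 / a) with hr_def
  have i1 : Integrable (fun x => 2 * (R / P) * ker b (y - x)) μ :=
    (integrable_ker_sub hb y).const_mul _
  have i2 : Integrable (fun x => (R / P) ^ 2 * ker a (y - x)) μ :=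
    (integrable_ker_sub ha y).const_mul _
  calc R ^ 2 / P = 2 * (R / P) * R - (R / P) ^ 2 * P := by field_simp; ring
    _ = ∫ x, 2 * (R / P) * ker b (y - x) - (R / P) ^ 2 * ker a (y - x) ∂μ := by
        rw [integral_sub i1 i2, integral_const_mul, integral_const_mul]; rfl
    _ ≤ _ := by
        refine integral_mono (i1.sub i2) (integrable_ker_sub hr y) fun x => ?_
        have h : ker b (y - x) ^ 2 = ker r (y - x) * ker a (y - x) := by
          rw [ker, ker, ker, ← Real.exp_add, ← Real.exp_nat_mul]
          congr 1
          have : 1 / r = 2 / b - 1 / a := by rw [hr_def, one_div_one_div]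
          calc ((2 : ℕ) : ℝ) * (-‖y - x‖ ^ 2 / (2 * b))
              = -‖y - x‖ ^ 2 / 2 * ((2 / b - 1 / a) + 1 / a) := by push_cast; ring
            _ = _ := by rw [← this]; field_simp; ring
        have ha' := ker_pos a (y - x)
        have : 0 ≤ (ker b (y - x) - R / P * ker a (y - x)) ^ 2 := sq_nonneg _
        have h3 : (ker b (y - x) - R / P * ker a (y - x)) ^ 2 = ker a (y - x) *
            (ker r (y - x) - (2 * (R / P) * ker b (y - x) - (R / P) ^ 2 * ker a (y - x))) := by
          rw [sub_sq, h]; ring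
        rw [h3] at this
        exact sub_nonneg.1 (nonneg_of_mul_nonneg_right this ha')

lemma integrable_smooth_ker_sq_div {a b : ℝ} (ha : 0 < a) (hb : 0 < b) (hab : b < 2 * a) :
    Integrable fun y : 𝔼 => smooth (ker b) μ y ^ 2 / smooth (ker a) μ y := by
  have hr : 0 < 1 / (2 / b - 1 / a) := by
    refine one_div_pos.2 ?_
    rw [sub_pos, div_lt_div_iff₀ ha hb]
    linarith
  have ma := (continuous_smooth (μ := μ) (continuous_ker (n := n) a) (abs_ker_le_one ha))
  have mb := (continuous_smooth (μ := μ) (continuous_ker (n := n) b) (abs_ker_le_one hb))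
  refine (integrable_smooth_ker (μ := μ) hr).mono'
    (mb.measurable.pow_const 2 |>.div ma.measurable).aestronglyMeasurable
    (Filter.Eventually.of_forall fun y => ?_)
  rw [Real.norm_eq_abs, abs_of_nonneg (div_nonneg (sq_nonneg _) (smooth_ker_pos ha y).le)]
  exact smooth_ker_sq_div_le ha hb hab y

lemma add_sub_le_mul_log {f a : ℝ} (hf : 0 ≤ f) (ha : 0 < a) :
    f * Real.log a + f - a ≤ f * Real.log f := by
  rcases hf.eq_or_lt with rfl | hf
  · simp [ha.le]
  · have h := Real.log_le_sub_one_of_pos (div_pos ha hf)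
    rw [Real.log_div ha.ne' hf.ne'] at h
    have h2 := mul_le_mul_of_nonneg_left h hf.le
    have h3 : f * (a / f - 1) = a - f := by field_simp
    linarith

lemma mul_log_div_le {t : ℝ} (ht : 0 < t) (hac : ν ≪ μ)
    (hKL : Integrable (fun x => Real.log (ν.rnDeriv μ x).toReal) ν) (y : 𝔼) :
    smooth (ker t) ν y * Real.log (smooth (ker t) ν y / smooth (ker t) μ y) ≤
      ∫ x, ((ν.rnDeriv μ x).toReal * Real.log (ν.rnDeriv μ x).toReal) * ker t (y - x) ∂μ := by
  have hP := smooth_ker_pos (μ := μ) ht y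
  have hQ := smooth_ker_pos (μ := ν) ht y
  have : ν.HaveLebesgueDecomposition μ := Measure.haveLebesgueDecomposition_of_finiteMeasure
  have hflog := (integrable_toReal_rnDeriv_mul_iff hac).2 hKL
  have hfK := (integrable_toReal_rnDeriv_mul_iff hac).2 (integrable_ker_sub (μ := ν) ht y)
  have hQ_eq := integral_toReal_rnDeriv_mul hac (f := fun x => ker t (y - x))
  change _ = smooth (ker t) ν y at hQ_eq
  set P := smooth (ker t) μ y
  set Q := smooth (ker t) ν y
  have hu : 0 < Q / P := div_pos hQ hP
  have i1 : Integrable (fun x => (Real.log (Q / P) + 1) *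
      ((ν.rnDeriv μ x).toReal * ker t (y - x))) μ := hfK.const_mul _
  have i2 : Integrable (fun x => Q / P * ker t (y - x)) μ := (integrable_ker_sub ht y).const_mul _
  calc Q * Real.log (Q / P) = (Real.log (Q / P) + 1) * Q - Q / P * P := by field_simp; ring
    _ = ∫ x, (Real.log (Q / P) + 1) * ((ν.rnDeriv μ x).toReal * ker t (y - x))
          - Q / P * ker t (y - x) ∂μ := by
        rw [integral_sub i1 i2, integral_const_mul, integral_const_mul, hQ_eq]; rfl
    _ ≤ _ := by
        refine integral_mono (i1.sub i2) (hflog.mul_bdd (c := 1)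
          (by have := continuous_ker (n := n) t; fun_prop)
          (Filter.Eventually.of_forall fun x => abs_ker_le_one ht _)) fun x => ?_
        have h := mul_le_mul_of_nonneg_right (add_sub_le_mul_log
          (ENNReal.toReal_nonneg (a := ν.rnDeriv μ x)) hu) (ker_pos t (y - x)).le
        calc _ = _ := by ring
          _ ≤ _ := h

lemma integrable_mul_log_div {t : ℝ} (ht : 0 < t) (hac : ν ≪ μ)
    (hKL : Integrable (fun x => Real.log (ν.rnDeriv μ x).toReal) ν) :
    Integrable fun y : 𝔼 =>
      smooth (ker t) ν y * Real.log (smooth (ker t) ν y / smooth (ker t) μ y) := by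
  have : ν.HaveLebesgueDecomposition μ := Measure.haveLebesgueDecomposition_of_finiteMeasure
  have hflog := (integrable_toReal_rnDeriv_mul_iff hac).2 hKL
  have hH := integrable_convolution_mul (integrable_ker (n := n) ht) hflog
  have mP := (continuous_smooth (μ := μ) (continuous_ker (n := n) t) (abs_ker_le_one ht)).measurable
  have mQ := (continuous_smooth (μ := ν) (continuous_ker (n := n) t) (abs_ker_le_one ht)).measurable
  refine (hH.abs.add (integrable_smooth_ker (μ := μ) ht)).mono' (by fun_prop)
    (Filter.Eventually.of_forall fun y => ?_)
  have hP := smooth_ker_pos (μ := μ) ht y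
  have hQ := smooth_ker_pos (μ := ν) ht y
  have h1 := mul_log_div_le ht hac hKL y
  have h2 := Real.one_sub_inv_le_log_of_pos (div_pos hQ hP)
  have h3 := mul_le_mul_of_nonneg_left h2 hQ.le
  have h4 : smooth (ker t) ν y * (1 - (smooth (ker t) ν y / smooth (ker t) μ y)⁻¹) =
    smooth (ker t) ν y - smooth (ker t) μ y := by field_simp
  rw [Real.norm_eq_abs, abs_le]
  simp only [Pi.add_apply]
  constructor
  · linarith [abs_nonneg (∫ x, ((ν.rnDeriv μ x).toReal *
      Real.log (ν.rnDeriv μ x).toReal) * ker t (y - x) ∂μ)]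
  · linarith [le_abs_self (∫ x, ((ν.rnDeriv μ x).toReal *
      Real.log (ν.rnDeriv μ x).toReal) * ker t (y - x) ∂μ)]

end Bounds

section Majorant

variable {μ ν : Measure (EuclideanSpace ℝ (Fin n))}

/-- The pointwise relative log-density of the two smoothed measures. -/
def logRatio (ν μ : Measure (EuclideanSpace ℝ (Fin n))) (t : ℝ)
    (y : EuclideanSpace ℝ (Fin n)) : ℝ :=
  Real.log (smooth (ker t) ν y / smooth (ker t) μ y)

/-- A bound for the logarithms `logRatio ν μ t` with `t` between `a` and `b`. -/
def logBound (ν μ : Measure (EuclideanSpace ℝ (Fin n))) (a b : ℝ)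
    (y : EuclideanSpace ℝ (Fin n)) : ℝ :=
  Real.log (smooth (ker b) μ y / smooth (ker a) μ y) +
    Real.log (smooth (ker b) ν y / smooth (ker a) ν y) + |logRatio ν μ b y|

/-- An integrable function dominating all the integrands at times between `a` and `b`. -/
def majorant (ν μ : Measure (EuclideanSpace ℝ (Fin n))) (a b : ℝ)
    (y : EuclideanSpace ℝ (Fin n)) : ℝ :=
  smooth (ker b) ν y * (1 + logBound ν μ a b y)

lemma measurable_smooth_ker [IsProbabilityMeasure μ] {t : ℝ} (ht : 0 < t) :
    Measurable (smooth (ker t) μ) :=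
  (continuous_smooth (continuous_ker t) (abs_ker_le_one ht)).measurable

lemma measurable_smooth_kerSq [IsProbabilityMeasure μ] {t : ℝ} (ht : 0 < t) :
    Measurable (smooth (kerSq t) μ) :=
  (continuous_smooth (continuous_kerSq t) (abs_kerSq_le ht)).measurable

lemma measurable_smooth_kerLin [IsProbabilityMeasure μ] {t : ℝ} (ht : 0 < t) {v : 𝔼}
    (hv : ‖v‖ = 1) : Measurable (smooth (kerLin t v) μ) :=
  (continuous_smooth (continuous_kerLin t v) (abs_kerLin_le_const ht hv)).measurable

lemma measurable_smooth_kerLinSq [IsProbabilityMeasure μ] {t : ℝ} (ht : 0 < t) {v : 𝔼}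
    (hv : ‖v‖ = 1) : Measurable (smooth (kerLinSq t v) μ) :=
  (continuous_smooth (continuous_kerLinSq t v) (abs_kerLinSq_le ht hv)).measurable

lemma log_smooth_div_nonneg [IsProbabilityMeasure μ] {a b : ℝ} (ha : 0 < a) (hab : a ≤ b) (y : 𝔼) :
    0 ≤ Real.log (smooth (ker b) μ y / smooth (ker a) μ y) :=
  Real.log_nonneg ((one_le_div (smooth_ker_pos ha y)).2 (smooth_ker_mono ha hab y))

lemma log_le_logBound [IsProbabilityMeasure ν] {a b : ℝ} (ha : 0 < a) (hab : a ≤ b) (y : 𝔼) :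
    Real.log (smooth (ker b) μ y / smooth (ker a) μ y) ≤ logBound ν μ a b y := by
  have h1 := log_smooth_div_nonneg (μ := ν) ha hab y
  have h2 := abs_nonneg (logRatio ν μ b y)
  rw [logBound]
  linarith

variable [IsProbabilityMeasure μ] [IsProbabilityMeasure ν]

lemma measurable_logRatio {t : ℝ} (ht : 0 < t) : Measurable (logRatio ν μ t) :=
  ((measurable_smooth_ker ht).div (measurable_smooth_ker ht)).log

lemma integrable_majorant {a b : ℝ} (ha : 0 < a) (hab : a ≤ b) (hba : b < 2 * a) (hac : ν ≪ μ)
    (hKL : Integrable (fun x => Real.log (ν.rnDeriv μ x).toReal) ν) :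
    Integrable (majorant ν μ a b) := by
  have hb : 0 < b := ha.trans_le hab
  have iQ := integrable_smooth_ker (μ := ν) hb
  have iP := integrable_smooth_ker (μ := μ) hb
  have iE := integrable_mul_log_div hb hac hKL
  have iR := integrable_smooth_ker_sq_div (μ := μ) ha hb hba
  have iS := integrable_smooth_ker_sq_div (μ := ν) ha hb hba
  have m1 := measurable_smooth_ker (μ := μ) ha
  have m2 := measurable_smooth_ker (μ := μ) hb
  have m3 := measurable_smooth_ker (μ := ν) ha
  have m4 := measurable_smooth_ker (μ := ν) hb
  have m5 := measurable_logRatio (ν := ν) (μ := μ) hb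
  have i1 : Integrable fun y => smooth (ker b) ν y *
      Real.log (smooth (ker b) μ y / smooth (ker a) μ y) := by
    refine ((iE.sub iQ).add iR).mono' (m4.mul (m2.div m1).log).aestronglyMeasurable
      (Filter.Eventually.of_forall fun y => ?_)
    have hQ := smooth_ker_pos (μ := ν) hb y
    have hP := smooth_ker_pos (μ := μ) hb y
    have hP' := smooth_ker_pos (μ := μ) ha y
    rw [Real.norm_eq_abs, abs_of_nonneg (mul_nonneg hQ.le (log_smooth_div_nonneg ha hab y))]
    simp only [Pi.add_apply, Pi.sub_apply]
    set Q := smooth (ker b) ν y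
    set P := smooth (ker b) μ y
    set R := P / smooth (ker a) μ y with hR_def
    have hR : 0 < R := div_pos hP hP'
    have h := Real.log_le_sub_one_of_pos (div_pos hR (div_pos hQ hP))
    rw [Real.log_div hR.ne' (div_pos hQ hP).ne'] at h
    have h2 := mul_le_mul_of_nonneg_left h hQ.le
    have h3 : Q * (R / (Q / P) - 1) = P ^ 2 / smooth (ker a) μ y - Q := by
      rw [hR_def]; field_simp
    linarith
  have i2 : Integrable fun y => smooth (ker b) ν y *
      Real.log (smooth (ker b) ν y / smooth (ker a) ν y) := by
    refine iS.mono' (m4.mul (m4.div m3).log).aestronglyMeasurable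
      (Filter.Eventually.of_forall fun y => ?_)
    have hQ := smooth_ker_pos (μ := ν) hb y
    have hQ' := smooth_ker_pos (μ := ν) ha y
    rw [Real.norm_eq_abs, abs_of_nonneg (mul_nonneg hQ.le (log_smooth_div_nonneg ha hab y)),
      sq, mul_div_assoc]
    have := Real.log_le_sub_one_of_pos (div_pos hQ hQ')
    gcongr
    linarith
  have i3 : Integrable fun y => smooth (ker b) ν y * |logRatio ν μ b y| := by
    refine iE.abs.congr (Filter.Eventually.of_forall fun y => ?_)
    simp only [abs_mul, abs_of_pos (smooth_ker_pos (μ := ν) hb y), logRatio]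
  refine (iQ.add ((i1.add i2).add i3)).congr (Filter.Eventually.of_forall fun y => ?_)
  simp only [Pi.add_apply, majorant, logBound]
  ring

variable {a b t C : ℝ}

lemma abs_logRatio_le (ha : 0 < a) (hat : a ≤ t) (htb : t ≤ b) (y : 𝔼) :
    |logRatio ν μ t y| ≤ logBound ν μ a b y := by
  have ht : 0 < t := ha.trans_le hat
  have hb : 0 < b := ht.trans_le htb
  have p1 := smooth_ker_pos (μ := μ) ha y
  have p2 := smooth_ker_pos (μ := μ) ht y
  have p3 := smooth_ker_pos (μ := μ) hb y
  have q1 := smooth_ker_pos (μ := ν) ha y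
  have q2 := smooth_ker_pos (μ := ν) ht y
  have q3 := smooth_ker_pos (μ := ν) hb y
  have l1 := Real.log_le_log p1 (smooth_ker_mono (μ := μ) ha hat y)
  have l2 := Real.log_le_log p2 (smooth_ker_mono (μ := μ) ht htb y)
  have l3 := Real.log_le_log q1 (smooth_ker_mono (μ := ν) ha hat y)
  have l4 := Real.log_le_log q2 (smooth_ker_mono (μ := ν) ht htb y)
  rw [logBound, logRatio, logRatio, Real.log_div q2.ne' p2.ne', Real.log_div q3.ne' p3.ne',
    Real.log_div p3.ne' p1.ne', Real.log_div q3.ne' q1.ne', abs_le]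
  constructor
  · linarith [neg_abs_le (Real.log (smooth (ker b) ν y) - Real.log (smooth (ker b) μ y))]
  · linarith [le_abs_self (Real.log (smooth (ker b) ν y) - Real.log (smooth (ker b) μ y))]

lemma smooth_kerSq_le_mul_log (ha : 0 < a) (hat : a ≤ t) (htb : t ≤ b) (hC : 0 ≤ C)
    (hCt : 1 ≤ C * (1 / (2 * t) - 1 / (2 * b))) (y : 𝔼) :
    smooth (kerSq t) μ y ≤
      C * (smooth (ker t) μ y * Real.log (smooth (ker b) μ y / smooth (ker a) μ y)) := by
  have ht : 0 < t := ha.trans_le hat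
  have hb : 0 < b := ht.trans_le htb
  have p1 := smooth_ker_pos (μ := μ) ha y
  have p2 := smooth_ker_pos (μ := μ) ht y
  have p3 := smooth_ker_pos (μ := μ) hb y
  calc smooth (kerSq t) μ y
      ≤ (C * (1 / (2 * t) - 1 / (2 * b))) * smooth (kerSq t) μ y :=
        le_mul_of_one_le_left (smooth_kerSq_nonneg t y) hCt
    _ = C * ((1 / (2 * t) - 1 / (2 * b)) * smooth (kerSq t) μ y) := by ring
    _ ≤ C * (smooth (ker t) μ y * Real.log (smooth (ker b) μ y / smooth (ker t) μ y)) :=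
        mul_le_mul_of_nonneg_left (smooth_kerSq_le ht hb y) hC
    _ ≤ _ := by
        gcongr
        exact smooth_ker_mono ha hat y

lemma smooth_kerSq_le_mul (ht : 0 < t) (hb : 0 < b) (hC : 0 ≤ C)
    (hCt : 1 ≤ C * (1 / (2 * t) - 1 / (2 * b))) (y : 𝔼) :
    smooth (kerSq t) μ y ≤ C * smooth (ker b) μ y := by
  have p2 := smooth_ker_pos (μ := μ) ht y
  have p3 := smooth_ker_pos (μ := μ) hb y
  calc smooth (kerSq t) μ y
      ≤ (C * (1 / (2 * t) - 1 / (2 * b))) * smooth (kerSq t) μ y :=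
        le_mul_of_one_le_left (smooth_kerSq_nonneg t y) hCt
    _ = C * ((1 / (2 * t) - 1 / (2 * b)) * smooth (kerSq t) μ y) := by ring
    _ ≤ C * (smooth (ker t) μ y * Real.log (smooth (ker b) μ y / smooth (ker t) μ y)) :=
        mul_le_mul_of_nonneg_left (smooth_kerSq_le ht hb y) hC
    _ ≤ C * (smooth (ker t) μ y * (smooth (ker b) μ y / smooth (ker t) μ y)) := by
        gcongr
        linarith [Real.log_le_sub_one_of_pos (div_pos p3 p2)]
    _ = _ := by field_simp

lemma logBound_nonneg (ha : 0 < a) (hab : a ≤ b) (y : 𝔼) : 0 ≤ logBound ν μ a b y :=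
  add_nonneg (add_nonneg (log_smooth_div_nonneg ha hab y) (log_smooth_div_nonneg ha hab y))
    (abs_nonneg _)

lemma smooth_ker_le_majorant (ha : 0 < a) (hat : a ≤ t) (htb : t ≤ b) (y : 𝔼) :
    smooth (ker t) ν y ≤ majorant ν μ a b y :=
  (smooth_ker_mono (ha.trans_le hat) htb y).trans (le_mul_of_one_le_right
    (smooth_ker_pos (ha.trans_le (hat.trans htb)) y).le
    (by linarith [logBound_nonneg (ν := ν) (μ := μ) ha (hat.trans htb) y]))

lemma smooth_kerSq_le_majorant (ha : 0 < a) (hat : a ≤ t) (htb : t ≤ b) (hC : 0 ≤ C)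
    (hCt : 1 ≤ C * (1 / (2 * t) - 1 / (2 * b))) (y : 𝔼) :
    smooth (kerSq t) ν y ≤ C * majorant ν μ a b y := by
  have ht : 0 < t := ha.trans_le hat
  have hb : 0 < b := ht.trans_le htb
  refine (smooth_kerSq_le_mul ht hb hC hCt y).trans ?_
  gcongr
  exact smooth_ker_le_majorant ha (hat.trans htb) le_rfl y

lemma abs_logRatio_add_one_le (ha : 0 < a) (hat : a ≤ t) (htb : t ≤ b) (y : 𝔼) :
    |logRatio ν μ t y + 1| ≤ 1 + logBound ν μ a b y := by
  have := abs_add_le (logRatio ν μ t y) 1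
  rw [abs_one] at this
  linarith [abs_logRatio_le (ν := ν) (μ := μ) ha hat htb y]

lemma abs_smooth_kerSq_mul_logRatio_le (ha : 0 < a) (hat : a ≤ t) (htb : t ≤ b) (hC : 0 ≤ C)
    (hCt : 1 ≤ C * (1 / (2 * t) - 1 / (2 * b))) (y : 𝔼) :
    smooth (kerSq t) ν y * |logRatio ν μ t y + 1| ≤ C * majorant ν μ a b y := by
  have ht : 0 < t := ha.trans_le hat
  have hb : 0 < b := ht.trans_le htb
  have h1 := abs_logRatio_add_one_le (ν := ν) (μ := μ) ha hat htb y
  have h2 := smooth_kerSq_le_mul (μ := ν) ht hb hC hCt y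
  have h4 := smooth_ker_pos (μ := ν) hb y
  rw [majorant, ← mul_assoc]
  gcongr

lemma ratio_mul_smooth_kerSq_le (ha : 0 < a) (hat : a ≤ t) (htb : t ≤ b) (hC : 0 ≤ C)
    (hCt : 1 ≤ C * (1 / (2 * t) - 1 / (2 * b))) (y : 𝔼) :
    smooth (ker t) ν y / smooth (ker t) μ y * smooth (kerSq t) μ y ≤
      C * majorant ν μ a b y := by
  have ht : 0 < t := ha.trans_le hat
  have hb : 0 < b := ht.trans_le htb
  have h1 := smooth_kerSq_le_mul_log (μ := μ) ha hat htb hC hCt y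
  have h2 := smooth_ker_mono (μ := ν) ht htb y
  have h3 := smooth_ker_pos (μ := ν) ht y
  have h4 := smooth_ker_pos (μ := ν) hb y
  have h5 := smooth_ker_pos (μ := μ) ht y
  have h6 := log_le_logBound (ν := ν) (μ := μ) ha (hat.trans htb) y
  have h7 := log_smooth_div_nonneg (μ := μ) ha (hat.trans htb) y
  calc _ ≤ smooth (ker t) ν y / smooth (ker t) μ y * (C * (smooth (ker t) μ y *
          Real.log (smooth (ker b) μ y / smooth (ker a) μ y))) := by gcongr
    _ = C * (smooth (ker t) ν y * Real.log (smooth (ker b) μ y / smooth (ker a) μ y)) := by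
        field_simp
    _ ≤ _ := by
        rw [majorant]
        gcongr
        linarith

end Majorant

section Derivative

variable {μ ν : Measure (EuclideanSpace ℝ (Fin n))}

/-- Up to a factor, the time derivative of the unnormalised relative entropy density. -/
def entropyRate (ν μ : Measure (EuclideanSpace ℝ (Fin n))) (t : ℝ)
    (y : EuclideanSpace ℝ (Fin n)) : ℝ :=
  smooth (kerSq t) ν y * (logRatio ν μ t y + 1) -
    smooth (ker t) ν y / smooth (ker t) μ y * smooth (kerSq t) μ y

/-- Up to a factor, the contribution of one direction to the Fisher information density. -/
def fisherTerm (ν μ : Measure (EuclideanSpace ℝ (Fin n))) (t : ℝ)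
    (v y : EuclideanSpace ℝ (Fin n)) : ℝ :=
  smooth (ker t) ν y * (smooth (kerLin t v) ν y / smooth (ker t) ν y -
    smooth (kerLin t v) μ y / smooth (ker t) μ y) ^ 2

/-- The vector field whose divergence links entropy dissipation to Fisher information. -/
def flux (ν μ : Measure (EuclideanSpace ℝ (Fin n))) (t : ℝ)
    (v y : EuclideanSpace ℝ (Fin n)) : ℝ :=
  smooth (kerLin t v) ν y * (logRatio ν μ t y + 1) -
    smooth (ker t) ν y / smooth (ker t) μ y * smooth (kerLin t v) μ y

/-- The contribution of one direction to `entropyRate`. -/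
def entropyRateTerm (ν μ : Measure (EuclideanSpace ℝ (Fin n))) (t : ℝ)
    (v y : EuclideanSpace ℝ (Fin n)) : ℝ :=
  smooth (kerLinSq t v) ν y * (logRatio ν μ t y + 1) -
    smooth (ker t) ν y / smooth (ker t) μ y * smooth (kerLinSq t v) μ y

lemma hasDerivAt_flux_aux {Q P A A' : ℝ → ℝ} {r s B B' : ℝ} (hs : s ≠ 0) (hQ0 : 0 < Q r)
    (hP0 : 0 < P r) (hQ : HasDerivAt Q (-(A r) / s) r) (hP : HasDerivAt P (-(A' r) / s) r)
    (hA : HasDerivAt A (Q r - B / s) r) (hA' : HasDerivAt A' (P r - B' / s) r) :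
    HasDerivAt (fun r => A r * (Real.log (Q r / P r) + 1) - Q r / P r * A' r)
      (Q r * Real.log (Q r / P r) - (B * (Real.log (Q r / P r) + 1) - Q r / P r * B' +
        Q r * (A r / Q r - A' r / P r) ^ 2) / s) r := by
  have h1 := hQ.div hP hP0.ne'
  have h2 := (h1.log (div_pos hQ0 hP0).ne').add_const 1
  refine ((hA.mul h2).sub (h1.mul hA')).congr_deriv ?_
  simp only [Pi.div_apply]
  field_simp
  ring

variable [IsProbabilityMeasure μ] [IsProbabilityMeasure ν]

lemma hasLineDerivAt_flux {t : ℝ} (ht : 0 < t) {v : 𝔼} (hv : ‖v‖ = 1) (y : 𝔼) :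
    HasLineDerivAt ℝ (flux ν μ t v) (smooth (ker t) ν y * logRatio ν μ t y -
      (entropyRateTerm ν μ t v y + fisherTerm ν μ t v y) / t) y v := by
  have h1 := hasLineDerivAt_smooth_ker (μ := ν) ht v y
  have h2 := hasLineDerivAt_smooth_ker (μ := μ) ht v y
  have h3 := hasLineDerivAt_smooth_kerLin (μ := ν) ht hv y
  have h4 := hasLineDerivAt_smooth_kerLin (μ := μ) ht hv y
  unfold HasLineDerivAt at *
  have h := hasDerivAt_flux_aux (r := 0) (s := t)
    (Q := fun r => smooth (ker t) ν (y + r • v)) (P := fun r => smooth (ker t) μ (y + r • v))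
    (A := fun r => smooth (kerLin t v) ν (y + r • v))
    (A' := fun r => smooth (kerLin t v) μ (y + r • v))
    (B := smooth (kerLinSq t v) ν y) (B' := smooth (kerLinSq t v) μ y)
    ht.ne' (smooth_ker_pos ht _) (smooth_ker_pos ht _)
  simp only [zero_smul, add_zero] at h
  exact h h1 h2 h3 h4

lemma hasDerivAt_integral_mul_logRatio {s : ℝ} (hs : 0 < s) (hac : ν ≪ μ)
    (hKL : Integrable (fun x => Real.log (ν.rnDeriv μ x).toReal) ν) :
    HasDerivAt (fun t => ∫ y, smooth (ker t) ν y * logRatio ν μ t y)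
      ((∫ y, entropyRate ν μ s y) / (2 * s ^ 2)) s := by
  have hmaj : Integrable (majorant ν μ (4 / 5 * s) (3 / 2 * s)) :=
    integrable_majorant (by positivity) (by linarith) (by linarith) hac hKL
  have key := hasDerivAt_integral_of_dominated_loc_of_deriv_le (μ := (volume : Measure 𝔼))
    (F := fun t y => smooth (ker t) ν y * logRatio ν μ t y)
    (F' := fun t y => entropyRate ν μ t y / (2 * t ^ 2))
    (bound := fun y => 24 * s * majorant ν μ (4 / 5 * s) (3 / 2 * s) y / (2 * (4 / 5 * s) ^ 2))
    (x₀ := s) (s := Set.Ioo (4 / 5 * s) (6 / 5 * s)) (Ioo_mem_nhds (by linarith) (by linarith))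
    (by
      filter_upwards [Ioi_mem_nhds hs] with t ht
      exact ((measurable_smooth_ker ht).mul (measurable_logRatio ht)).aestronglyMeasurable)
    (integrable_mul_log_div hs hac hKL)
    ((((measurable_smooth_kerSq hs).mul ((measurable_logRatio hs).add_const 1)).sub
      (((measurable_smooth_ker hs).div (measurable_smooth_ker hs)).mul
        (measurable_smooth_kerSq hs))).div_const _).aestronglyMeasurable
    (Filter.Eventually.of_forall fun y t ht => by
      have h45 : 0 < 4 / 5 * s := by positivity
      have ht0 : 0 < t := h45.trans ht.1
      have htb : t ≤ 3 / 2 * s := by linarith [ht.2]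
      have hC : 1 ≤ 12 * s * (1 / (2 * t) - 1 / (2 * (3 / 2 * s))) := by
        have : 1 / (2 * (6 / 5 * s)) ≤ 1 / (2 * t) := by gcongr; exact ht.2.le
        calc 1 = 12 * s * (1 / (2 * (6 / 5 * s)) - 1 / (2 * (3 / 2 * s))) := by
              field_simp; norm_num
          _ ≤ _ := by gcongr
      have b1 := abs_smooth_kerSq_mul_logRatio_le (ν := ν) (μ := μ) h45 ht.1.le htb
        (by positivity) hC y
      have b2 := ratio_mul_smooth_kerSq_le (ν := ν) (μ := μ) h45 ht.1.le htb
        (by positivity) hC y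
      rw [Real.norm_eq_abs, abs_div, abs_of_pos (a := 2 * t ^ 2) (by positivity)]
      have b0 : |entropyRate ν μ t y| ≤ 24 * s * majorant ν μ (4 / 5 * s) (3 / 2 * s) y := by
        refine (abs_sub _ _).trans ?_
        rw [abs_mul, abs_of_nonneg (smooth_kerSq_nonneg t y), abs_of_nonneg (a := _ * _)
          (mul_nonneg (div_pos (smooth_ker_pos ht0 y) (smooth_ker_pos ht0 y)).le
            (smooth_kerSq_nonneg t y))]
        linarith
      have b3 := (abs_nonneg _).trans b0
      have := ht.1.le
      gcongr)
    ((hmaj.const_mul _).div_const _)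
    (Filter.Eventually.of_forall fun y t ht => by
      have ht0 : 0 < t := (by positivity : 0 < 4 / 5 * s).trans ht.1
      have hQ := smooth_ker_pos (μ := ν) ht0 y
      have hP := smooth_ker_pos (μ := μ) ht0 y
      have h1 := hasDerivAt_smooth_ker (μ := ν) ht0 y
      have h2 := hasDerivAt_smooth_ker (μ := μ) ht0 y
      refine (h1.mul ((h1.div h2 hP.ne').log (div_pos hQ hP).ne')).congr_deriv ?_
      simp only [entropyRate, logRatio, Pi.div_apply]
      field_simp
      ring)
  refine key.2.congr_deriv ?_
  rw [integral_div]

end Derivative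

section Parts

lemma fisherTerm_nonneg {μ ν : Measure (EuclideanSpace ℝ (Fin n))} [IsProbabilityMeasure ν]
    {t : ℝ} (ht : 0 < t) (v y : 𝔼) : 0 ≤ fisherTerm ν μ t v y :=
  mul_nonneg (smooth_ker_pos ht y).le (sq_nonneg _)

variable {μ ν : Measure (EuclideanSpace ℝ (Fin n))} [IsProbabilityMeasure μ]
  [IsProbabilityMeasure ν] {t a b C : ℝ} {v : EuclideanSpace ℝ (Fin n)}

lemma abs_flux_le (ha : 0 < a) (hat : a ≤ t) (htb : t ≤ b) (hC : 0 ≤ C)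
    (hCt : 1 ≤ C * (1 / (2 * t) - 1 / (2 * b))) (hv : ‖v‖ = 1) (y : 𝔼) :
    |flux ν μ t v y| ≤ (2 + 2 * C) * majorant ν μ a b y := by
  have ht : 0 < t := ha.trans_le hat
  have hb : 0 < b := ht.trans_le htb
  have hQ := smooth_ker_pos (μ := ν) ht y
  have hP := smooth_ker_pos (μ := μ) ht y
  have h1 := abs_smooth_kerLin_le (μ := ν) ht hv y
  have h2 := abs_smooth_kerLin_le (μ := μ) ht hv y
  have h3 := abs_smooth_kerSq_mul_logRatio_le (ν := ν) (μ := μ) ha hat htb hC hCt y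
  have h4 := ratio_mul_smooth_kerSq_le (ν := ν) (μ := μ) ha hat htb hC hCt y
  have h5 := smooth_ker_le_majorant (ν := ν) (μ := μ) ha hat htb y
  have h6 := abs_logRatio_add_one_le (ν := ν) (μ := μ) ha hat htb y
  have h7 : smooth (ker t) ν y * |logRatio ν μ t y + 1| ≤ majorant ν μ a b y :=
    mul_le_mul (smooth_ker_mono ht htb y) h6 (abs_nonneg _) (smooth_ker_pos hb y).le
  have hr : 0 < smooth (ker t) ν y / smooth (ker t) μ y := div_pos hQ hP
  calc |flux ν μ t v y| ≤ |smooth (kerLin t v) ν y| * |logRatio ν μ t y + 1| +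
        smooth (ker t) ν y / smooth (ker t) μ y * |smooth (kerLin t v) μ y| := by
        refine (abs_sub _ _).trans ?_
        rw [abs_mul, abs_mul (_ / _), abs_of_pos hr]
    _ ≤ (smooth (ker t) ν y + smooth (kerSq t) ν y) * |logRatio ν μ t y + 1| +
        smooth (ker t) ν y / smooth (ker t) μ y *
          (smooth (ker t) μ y + smooth (kerSq t) μ y) := by gcongr
    _ = smooth (ker t) ν y * |logRatio ν μ t y + 1| +
        smooth (kerSq t) ν y * |logRatio ν μ t y + 1| + smooth (ker t) ν y +
        smooth (ker t) ν y / smooth (ker t) μ y * smooth (kerSq t) μ y := by field_simp; ring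
    _ ≤ _ := by linarith

lemma abs_entropyRateTerm_le (ha : 0 < a) (hat : a ≤ t) (htb : t ≤ b) (hC : 0 ≤ C)
    (hCt : 1 ≤ C * (1 / (2 * t) - 1 / (2 * b))) (hv : ‖v‖ = 1) (y : 𝔼) :
    |entropyRateTerm ν μ t v y| ≤ 2 * C * majorant ν μ a b y := by
  have ht : 0 < t := ha.trans_le hat
  have hr : 0 < smooth (ker t) ν y / smooth (ker t) μ y :=
    div_pos (smooth_ker_pos ht y) (smooth_ker_pos ht y)
  have h1 := smooth_kerLinSq_le (μ := ν) ht hv y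
  have h2 := smooth_kerLinSq_le (μ := μ) ht hv y
  have h3 := abs_smooth_kerSq_mul_logRatio_le (ν := ν) (μ := μ) ha hat htb hC hCt y
  have h4 := ratio_mul_smooth_kerSq_le (ν := ν) (μ := μ) ha hat htb hC hCt y
  calc |entropyRateTerm ν μ t v y| ≤ smooth (kerLinSq t v) ν y * |logRatio ν μ t y + 1| +
        smooth (ker t) ν y / smooth (ker t) μ y * smooth (kerLinSq t v) μ y := by
        refine (abs_sub _ _).trans ?_
        rw [abs_mul, abs_mul (_ / _), abs_of_pos hr, abs_of_nonneg (smooth_kerLinSq_nonneg t v y),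
          abs_of_nonneg (smooth_kerLinSq_nonneg t v y)]
    _ ≤ smooth (kerSq t) ν y * |logRatio ν μ t y + 1| +
        smooth (ker t) ν y / smooth (ker t) μ y * smooth (kerSq t) μ y := by gcongr
    _ ≤ _ := by linarith

lemma fisherTerm_le (ha : 0 < a) (hat : a ≤ t) (htb : t ≤ b) (hC : 0 ≤ C)
    (hCt : 1 ≤ C * (1 / (2 * t) - 1 / (2 * b))) (hv : ‖v‖ = 1) (y : 𝔼) :
    fisherTerm ν μ t v y ≤ 4 * C * majorant ν μ a b y := by
  have ht : 0 < t := ha.trans_le hat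
  have hQ := smooth_ker_pos (μ := ν) ht y
  have hP := smooth_ker_pos (μ := μ) ht y
  have h1 := smooth_kerLin_sq_le (μ := ν) ht hv y
  have h2 := smooth_kerLin_sq_le (μ := μ) ht hv y
  have h3 := (smooth_kerLinSq_le (μ := ν) ht hv y).trans
    (smooth_kerSq_le_majorant (μ := μ) ha hat htb hC hCt y)
  have h4 := ratio_mul_smooth_kerSq_le (ν := ν) (μ := μ) ha hat htb hC hCt y
  have h5 := smooth_kerLinSq_le (μ := μ) ht hv y
  have hr : 0 < smooth (ker t) ν y / smooth (ker t) μ y := div_pos hQ hP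
  unfold fisherTerm
  set Q := smooth (ker t) ν y
  set P := smooth (ker t) μ y
  set A := smooth (kerLin t v) ν y
  set A' := smooth (kerLin t v) μ y
  calc Q * (A / Q - A' / P) ^ 2 ≤ Q * (2 * ((A / Q) ^ 2 + (A' / P) ^ 2)) := by
        gcongr
        linarith [sq_nonneg (A / Q + A' / P)]
    _ = 2 * (A ^ 2 / Q + Q / P * (A' ^ 2 / P)) := by field_simp
    _ ≤ 2 * (Q * smooth (kerLinSq t v) ν y / Q +
        Q / P * (P * smooth (kerLinSq t v) μ y / P)) := by gcongr
    _ = 2 * (smooth (kerLinSq t v) ν y + Q / P * smooth (kerLinSq t v) μ y) := by field_simp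
    _ ≤ 2 * (smooth (kerLinSq t v) ν y + Q / P * smooth (kerSq t) μ y) := by gcongr
    _ ≤ _ := by linarith

lemma integrable_flux (ha : 0 < a) (hat : a ≤ t) (htb : t ≤ b) (hC : 0 ≤ C)
    (hCt : 1 ≤ C * (1 / (2 * t) - 1 / (2 * b))) (hv : ‖v‖ = 1)
    (hmaj : Integrable (majorant ν μ a b)) : Integrable (flux ν μ t v) := by
  have ht : 0 < t := ha.trans_le hat
  refine (hmaj.const_mul (2 + 2 * C)).mono' (Measurable.aestronglyMeasurable ?_)
    (Filter.Eventually.of_forall fun y => abs_flux_le ha hat htb hC hCt hv y)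
  exact ((measurable_smooth_kerLin ht hv).mul ((measurable_logRatio ht).add_const 1)).sub
    (((measurable_smooth_ker ht).div (measurable_smooth_ker ht)).mul
      (measurable_smooth_kerLin ht hv))

lemma integrable_entropyRateTerm (ha : 0 < a) (hat : a ≤ t) (htb : t ≤ b) (hC : 0 ≤ C)
    (hCt : 1 ≤ C * (1 / (2 * t) - 1 / (2 * b))) (hv : ‖v‖ = 1)
    (hmaj : Integrable (majorant ν μ a b)) : Integrable (entropyRateTerm ν μ t v) := by
  have ht : 0 < t := ha.trans_le hat
  refine (hmaj.const_mul (2 * C)).mono' (Measurable.aestronglyMeasurable ?_)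
    (Filter.Eventually.of_forall fun y => abs_entropyRateTerm_le ha hat htb hC hCt hv y)
  exact ((measurable_smooth_kerLinSq ht hv).mul ((measurable_logRatio ht).add_const 1)).sub
    (((measurable_smooth_ker ht).div (measurable_smooth_ker ht)).mul
      (measurable_smooth_kerLinSq ht hv))

lemma integrable_fisherTerm (ha : 0 < a) (hat : a ≤ t) (htb : t ≤ b) (hC : 0 ≤ C)
    (hCt : 1 ≤ C * (1 / (2 * t) - 1 / (2 * b))) (hv : ‖v‖ = 1)
    (hmaj : Integrable (majorant ν μ a b)) : Integrable (fisherTerm ν μ t v) := by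
  have ht : 0 < t := ha.trans_le hat
  refine (hmaj.const_mul (4 * C)).mono' (Measurable.aestronglyMeasurable ?_)
    (Filter.Eventually.of_forall fun y => ?_)
  · exact (measurable_smooth_ker ht).mul ((((measurable_smooth_kerLin ht hv).div
      (measurable_smooth_ker ht)).sub ((measurable_smooth_kerLin ht hv).div
      (measurable_smooth_ker ht))).pow_const 2)
  · rw [Real.norm_eq_abs, abs_of_nonneg (fisherTerm_nonneg ht v y)]
    exact fisherTerm_le ha hat htb hC hCt hv y

lemma integral_eq_zero_of_hasLineDerivAt {f f' : 𝔼 → ℝ} (hf : Integrable f)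
    (hf' : Integrable f') (h : ∀ y, HasLineDerivAt ℝ f (f' y) y v) : ∫ y, f' y = 0 := by
  have key := integral_bilinear_hasLineDerivAt_right_eq_neg_left_of_integrable
    (μ := (volume : Measure 𝔼)) (B := ContinuousLinearMap.mul ℝ ℝ) (v := v)
    (f := fun _ => (1 : ℝ)) (f' := fun _ => (0 : ℝ)) (g := f) (g' := f')
    (by simp) (by simpa using hf') (by simpa using hf)
    (fun y _ => by
      unfold HasLineDerivAt
      exact hasDerivAt_const _ _) (fun y _ => h y)
  simpa using key

/-- Integration by parts in the direction `v`. -/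
lemma integral_mul_logRatio_eq {s : ℝ} (hs : 0 < s) (hv : ‖v‖ = 1) (hac : ν ≪ μ)
    (hKL : Integrable (fun x => Real.log (ν.rnDeriv μ x).toReal) ν) :
    Integrable (entropyRateTerm ν μ s v) ∧ Integrable (fisherTerm ν μ s v) ∧
    ∫ y, smooth (ker s) ν y * logRatio ν μ s y =
      ((∫ y, entropyRateTerm ν μ s v y) + ∫ y, fisherTerm ν μ s v y) / s := by
  have hmaj : Integrable (majorant ν μ (4 / 5 * s) (3 / 2 * s)) :=
    integrable_majorant (by positivity) (by linarith) (by linarith) hac hKL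
  have ha : 0 < 4 / 5 * s := by positivity
  have hat : 4 / 5 * s ≤ s := by linarith
  have htb : s ≤ 3 / 2 * s := by linarith
  have hC0 : 0 ≤ 12 * s := by positivity
  have hC : 1 ≤ 12 * s * (1 / (2 * s) - 1 / (2 * (3 / 2 * s))) := by
    have : 12 * s * (1 / (2 * s) - 1 / (2 * (3 / 2 * s))) = 2 := by field_simp; norm_num
    linarith
  have i1 := integrable_entropyRateTerm ha hat htb hC0 hC hv hmaj
  have i2 := integrable_fisherTerm ha hat htb hC0 hC hv hmaj
  have i3 := integrable_flux ha hat htb hC0 hC hv hmaj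
  have i4 : Integrable fun y => smooth (ker s) ν y * logRatio ν μ s y :=
    integrable_mul_log_div hs hac hKL
  refine ⟨i1, i2, ?_⟩
  have h := integral_eq_zero_of_hasLineDerivAt i3 (i4.sub ((i1.add i2).div_const s))
    (hasLineDerivAt_flux hs hv)
  have h1 := integral_sub i4 ((i1.add i2).div_const s)
  have h2 := integral_add i1 i2
  simp only [Pi.sub_apply, Pi.add_apply, integral_div] at h h1 h2
  rw [h1, h2] at h
  linarith

end Parts

section Dissipation

variable {μ ν : Measure (EuclideanSpace ℝ (Fin n))}

lemma norm_single_one (i : Fin n) : ‖(EuclideanSpace.single i 1 : 𝔼)‖ = 1 := by simp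

lemma sum_kerLinSq_single (t : ℝ) (z : 𝔼) :
    ∑ i, kerLinSq t (EuclideanSpace.single i 1) z = kerSq t z := by
  simp only [kerLinSq, kerSq, ← Finset.sum_mul, EuclideanSpace.inner_single_left,
    EuclideanSpace.real_norm_sq_eq, map_one, one_mul]

lemma sum_smooth_kerLinSq_single [IsFiniteMeasure μ] {t : ℝ} (ht : 0 < t) (y : 𝔼) :
    ∑ i, smooth (kerLinSq t (EuclideanSpace.single i 1)) μ y = smooth (kerSq t) μ y := by
  simp only [smooth, ← sum_kerLinSq_single]
  exact (integral_finsetSum _ fun i _ => integrable_comp_sub (continuous_kerLinSq t _)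
    (abs_kerLinSq_le ht (norm_single_one i)) y).symm

lemma sum_entropyRateTerm_single [IsFiniteMeasure μ] [IsFiniteMeasure ν] {t : ℝ} (ht : 0 < t)
    (y : 𝔼) :
    ∑ i, entropyRateTerm ν μ t (EuclideanSpace.single i 1) y = entropyRate ν μ t y := by
  simp only [entropyRateTerm, entropyRate, Finset.sum_sub_distrib, ← Finset.sum_mul,
    ← Finset.mul_sum, sum_smooth_kerLinSq_single ht]

/-- The unnormalised relative Fisher information density. -/
def fisherSum (ν μ : Measure (EuclideanSpace ℝ (Fin n))) (t : ℝ)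
    (y : EuclideanSpace ℝ (Fin n)) : ℝ :=
  ∑ i, fisherTerm ν μ t (EuclideanSpace.single i 1) y

variable [IsProbabilityMeasure μ] [IsProbabilityMeasure ν]

lemma integral_entropyRate_eq {s : ℝ} (hs : 0 < s) (hac : ν ≪ μ)
    (hKL : Integrable (fun x => Real.log (ν.rnDeriv μ x).toReal) ν) :
    ∫ y, entropyRate ν μ s y =
      n * s * (∫ y, smooth (ker s) ν y * logRatio ν μ s y) - ∫ y, fisherSum ν μ s y := by
  have key := fun i : Fin n => integral_mul_logRatio_eq hs (norm_single_one i) hac hKL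
  have h1 : ∫ y, entropyRate ν μ s y =
      ∑ i, ∫ y, entropyRateTerm ν μ s (EuclideanSpace.single i 1) y := by
    simp only [← sum_entropyRateTerm_single hs]
    exact integral_finsetSum _ fun i _ => (key i).1
  have h2 : ∫ y, fisherSum ν μ s y =
      ∑ i, ∫ y, fisherTerm ν μ s (EuclideanSpace.single i 1) y :=
    integral_finsetSum _ fun i _ => (key i).2.1
  have h3 : ∑ _i : Fin n, s * ∫ y, smooth (ker s) ν y * logRatio ν μ s y =
      (∫ y, entropyRate ν μ s y) + ∫ y, fisherSum ν μ s y := by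
    rw [h1, h2, ← Finset.sum_add_distrib]
    refine Finset.sum_congr rfl fun i _ => ?_
    rw [(key i).2.2]
    field_simp
  rw [Finset.sum_const, Finset.card_univ, Fintype.card_fin, nsmul_eq_mul] at h3
  linarith

lemma hasDerivAt_normalized_entropy {s : ℝ} (hs : 0 < s) (hac : ν ≪ μ)
    (hKL : Integrable (fun x => Real.log (ν.rnDeriv μ x).toReal) ν) :
    HasDerivAt (fun t => (2 * π * t) ^ (-(n : ℝ) / 2) *
        ∫ y, smooth (ker t) ν y * logRatio ν μ t y)
      (-(1 / 2) * ((2 * π * s) ^ (-(n : ℝ) / 2) / s ^ 2 * ∫ y, fisherSum ν μ s y)) s := by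
  have hc : 0 < 2 * π * s := by positivity
  have h1 : HasDerivAt (fun t : ℝ => (2 * π * t) ^ (-(n : ℝ) / 2))
      (2 * π * (-(n : ℝ) / 2) * (2 * π * s) ^ (-(n : ℝ) / 2 - 1)) s := by
    have := ((hasDerivAt_id s).const_mul (2 * π)).rpow_const (p := -(n : ℝ) / 2)
      (Or.inl hc.ne')
    simpa using this
  refine (h1.mul (hasDerivAt_integral_mul_logRatio hs hac hKL)).congr_deriv ?_
  rw [integral_entropyRate_eq hs hac hKL, Real.rpow_sub_one hc.ne']
  field_simp
  ring

end Dissipation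

section HeatFlow

variable {μ ν : Measure (EuclideanSpace ℝ (Fin n))}

lemma heatDensity_eq (t : ℝ) (y : 𝔼) :
    heatDensity μ t y = (2 * π * t) ^ (-(n : ℝ) / 2) * smooth (ker t) μ y :=
  integral_const_mul _ _

lemma heatRatio_eq {t : ℝ} (ht : 0 < t) :
    heatRatio ν μ t = fun y => smooth (ker t) ν y / smooth (ker t) μ y := by
  ext y
  rw [heatRatio, heatDensity_eq, heatDensity_eq, mul_div_mul_left]
  positivity

variable [IsProbabilityMeasure μ] [IsProbabilityMeasure ν]

lemma norm_sq_eq_sum_apply_single (T : 𝔼 →L[ℝ] ℝ) :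
    ‖T‖ ^ 2 = ∑ i, T (EuclideanSpace.single i 1) ^ 2 := by
  obtain ⟨w, rfl⟩ := (InnerProductSpace.toDual ℝ 𝔼).surjective T
  simp only [LinearIsometryEquiv.norm_map, InnerProductSpace.toDual_apply_apply,
    EuclideanSpace.real_norm_sq_eq, EuclideanSpace.inner_single_right]
  simp

lemma norm_fderiv_heatRatio_sq_div {t : ℝ} (ht : 0 < t) (y : 𝔼) :
    smooth (ker t) μ y * (‖fderiv ℝ (heatRatio ν μ t) y‖ ^ 2 / heatRatio ν μ t y) =
      fisherSum ν μ t y / t ^ 2 := by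
  have hQ := smooth_ker_pos (μ := ν) ht y
  have hP := smooth_ker_pos (μ := μ) ht y
  obtain ⟨T, hT, hTv⟩ := exists_hasFDerivAt_smooth_ker (μ := ν) ht y
  obtain ⟨S, hS, hSv⟩ := exists_hasFDerivAt_smooth_ker (μ := μ) ht y
  have h := hT.mul ((hasDerivAt_inv hP.ne').comp_hasFDerivAt y hS)
  have h1 : heatRatio ν μ t = smooth (ker t) ν * (fun x => x⁻¹) ∘ smooth (ker t) μ := by
    ext z
    simp [heatRatio_eq ht, div_eq_mul_inv]
  rw [norm_sq_eq_sum_apply_single, fisherSum, Finset.sum_div, Finset.sum_div, Finset.mul_sum, h1,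
    h.fderiv]
  refine Finset.sum_congr rfl fun i _ => ?_
  simp only [add_apply, smul_apply, hTv, hSv,
    smul_eq_mul, fisherTerm, Function.comp_apply, Pi.mul_apply]
  field_simp
  ring

lemma measurable_heatDensity {t : ℝ} (ht : 0 < t) : Measurable (heatDensity μ t) := by
  have : heatDensity μ t = fun y => (2 * π * t) ^ (-(n : ℝ) / 2) * smooth (ker t) μ y :=
    funext (heatDensity_eq t)
  rw [this]
  exact (measurable_smooth_ker ht).const_mul _

lemma heatDensity_pos {t : ℝ} (ht : 0 < t) (y : 𝔼) : 0 < heatDensity μ t y := by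
  rw [heatDensity_eq]
  have := smooth_ker_pos (μ := μ) ht y
  positivity

lemma lintegral_comp_add_smul {F : 𝔼 → ℝ≥0∞} (hF : Measurable F) (x : 𝔼) {r : ℝ} (hr : 0 < r) :
    ∫⁻ z, F (x + r • z) = ENNReal.ofReal ((r ^ n)⁻¹) * ∫⁻ y, F y := by
  have h := lintegral_map (μ := (volume : Measure 𝔼)) (f := fun z => F (x + z))
    (g := fun z => r • z) (by fun_prop) (by fun_prop)
  rw [← h, Measure.map_addHaar_smul _ hr.ne', lintegral_smul_measure,
    lintegral_add_left_eq_self F x, finrank_euclideanSpace_fin, abs_of_pos (by positivity),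
    smul_eq_mul]

lemma gaussDensity_add_smul {t : ℝ} (ht : 0 < t) (x z : 𝔼) :
    (2 * π) ^ (-(n : ℝ) / 2) * Real.exp (-‖z‖ ^ 2 / 2) =
      √t ^ n * gaussDensity n t (x + √t • z - x) := by
  have h1 : (2 * π * t) ^ (-(n : ℝ) / 2) = (2 * π) ^ (-(n : ℝ) / 2) * (√t ^ n)⁻¹ := by
    rw [Real.mul_rpow (by positivity) ht.le, Real.sqrt_eq_rpow, ← Real.rpow_natCast,
      ← Real.rpow_mul ht.le, ← Real.rpow_neg ht.le]
    congr 2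
    ring
  have h2 : -‖√t • z‖ ^ 2 / (2 * t) = -‖z‖ ^ 2 / 2 := by
    rw [norm_smul, mul_pow, Real.norm_eq_abs, sq_abs, Real.sq_sqrt ht.le]
    field_simp
  rw [gaussDensity, add_sub_cancel_left, h1, h2]
  have : 0 < √t := Real.sqrt_pos.2 ht
  field_simp

lemma continuous_gaussDensity (t : ℝ) : Continuous (gaussDensity n t) :=
  continuous_const.mul (continuous_ker t)

lemma gaussDensity_nonneg {t : ℝ} (ht : 0 < t) (z : 𝔼) : 0 ≤ gaussDensity n t z := by
  unfold gaussDensity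
  positivity

instance : SFinite (_root_.stdGaussian n) := by
  unfold _root_.stdGaussian
  infer_instance

lemma heatFlow_eq_withDensity {t : ℝ} (ht : 0 < t) :
    heatFlow μ t = volume.withDensity fun y => ENNReal.ofReal (heatDensity μ t y) := by
  have hr : 0 < √t := Real.sqrt_pos.2 ht
  have hg := continuous_gaussDensity (n := n) t
  refine Measure.ext_of_lintegral _ fun F hF => ?_
  rw [heatFlow, lintegral_map hF (by fun_prop), lintegral_prod _ (by fun_prop),
    lintegral_withDensity_eq_lintegral_mul _ (measurable_heatDensity ht).ennreal_ofReal hF]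
  have h1 : ∀ x : 𝔼, ∫⁻ z, F (x + √t • z) ∂(_root_.stdGaussian n) =
      ∫⁻ y, ENNReal.ofReal (gaussDensity n t (y - x)) * F y := fun x => by
    rw [_root_.stdGaussian, lintegral_withDensity_eq_lintegral_mul _ (by fun_prop) (by fun_prop)]
    simp only [Pi.mul_apply, gaussDensity_add_smul ht x, ENNReal.ofReal_mul (pow_nonneg hr.le n),
      mul_assoc]
    rw [lintegral_const_mul _ (by fun_prop), lintegral_comp_add_smul
      (F := fun y => ENNReal.ofReal (gaussDensity n t (y - x)) * F y) (by fun_prop) x hr,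
      ← mul_assoc, ← ENNReal.ofReal_mul (by positivity), mul_inv_cancel₀ (by positivity),
      ENNReal.ofReal_one, one_mul]
  simp only [h1]
  rw [lintegral_lintegral_swap (by fun_prop)]
  refine lintegral_congr fun y => ?_
  rw [lintegral_mul_const _ (by fun_prop), Pi.mul_apply, heatDensity,
    ofReal_integral_eq_lintegral_ofReal _ (Filter.Eventually.of_forall fun x =>
      gaussDensity_nonneg ht _)]
  exact (integrable_comp_sub (continuous_ker t) (abs_ker_le_one ht) y).const_mul _

lemma integral_heatFlow {t : ℝ} (ht : 0 < t) (g : 𝔼 → ℝ) :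
    ∫ y, g y ∂(heatFlow μ t) =
      (2 * π * t) ^ (-(n : ℝ) / 2) * ∫ y, smooth (ker t) μ y * g y := by
  rw [heatFlow_eq_withDensity ht, integral_withDensity_eq_integral_toReal_smul
    (measurable_heatDensity ht).ennreal_ofReal (Filter.Eventually.of_forall fun _ =>
      ENNReal.ofReal_lt_top), ← integral_const_mul]
  refine integral_congr_ae (Filter.Eventually.of_forall fun y => ?_)
  beta_reduce
  rw [ENNReal.toReal_ofReal (heatDensity_pos ht y).le, heatDensity_eq, smul_eq_mul, mul_assoc]

lemma klDiv_heatFlow {t : ℝ} (ht : 0 < t) :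
    _root_.klDiv (heatFlow ν t) (heatFlow μ t) =
      (2 * π * t) ^ (-(n : ℝ) / 2) * ∫ y, smooth (ker t) ν y * logRatio ν μ t y := by
  have hm : Measurable fun y => ENNReal.ofReal (heatRatio ν μ t y) :=
    ((measurable_heatDensity ht).div (measurable_heatDensity ht)).ennreal_ofReal
  have h1 : heatFlow ν t =
      (heatFlow μ t).withDensity fun y => ENNReal.ofReal (heatRatio ν μ t y) := by
    rw [heatFlow_eq_withDensity ht, heatFlow_eq_withDensity ht,
      ← withDensity_mul _ (measurable_heatDensity ht).ennreal_ofReal hm]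
    congr 1
    ext y
    have := heatDensity_pos (μ := μ) ht y
    rw [Pi.mul_apply, ← ENNReal.ofReal_mul this.le, heatRatio, mul_div_cancel₀ _ this.ne']
  have hσ : SigmaFinite (heatFlow μ t) := by
    rw [heatFlow_eq_withDensity ht]
    infer_instance
  have h2 : (heatFlow ν t).rnDeriv (heatFlow μ t) =ᵐ[heatFlow ν t]
      fun y => ENNReal.ofReal (heatRatio ν μ t y) := by
    have hac : heatFlow ν t ≪ heatFlow μ t := by
      rw [h1]
      exact withDensity_absolutelyContinuous _ _
    refine hac.ae_le ?_
    rw [h1]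
    exact Measure.rnDeriv_withDensity _ hm
  rw [_root_.klDiv, ← integral_heatFlow ht]
  refine integral_congr_ae ?_
  filter_upwards [h2] with y hy
  have : 0 ≤ heatRatio ν μ t y := (div_pos (heatDensity_pos ht y) (heatDensity_pos ht y)).le
  rw [hy, ENNReal.toReal_ofReal this, heatRatio_eq ht, logRatio]

end HeatFlow

end HeatKL

/-- Generalized de Bruijn identity for the KL divergence:
`d/ds D(ν_s‖μ_s) = −(1/2) J(ν_s‖μ_s)` with `J(ν_s‖μ_s) = ∫ |∇f_s|²/f_s dμ_s`,
`f_s = dν_s/dμ_s`. -/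
theorem stmt7 {n : ℕ} (μ ν : Measure (EuclideanSpace ℝ (Fin n)))
    [IsProbabilityMeasure μ] [IsProbabilityMeasure ν]
    (hac : ν ≪ μ)
    (hKL : Integrable (fun x => Real.log (ν.rnDeriv μ x).toReal) ν)
    (hmom : Integrable (fun x => ‖x‖ ^ 4) μ) :
    ∀ s : ℝ, 0 < s →
      HasDerivAt (fun t => klDiv (heatFlow ν t) (heatFlow μ t))
        (-(1 / 2) * ∫ y, ‖fderiv ℝ (heatRatio ν μ s) y‖ ^ 2 / heatRatio ν μ s y
          ∂(heatFlow μ s)) s := by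
  intro s hs
  have h : (fun t => klDiv (heatFlow ν t) (heatFlow μ t)) =ᶠ[nhds s] fun t =>
      (2 * π * t) ^ (-(n : ℝ) / 2) *
        ∫ y, HeatKL.smooth (HeatKL.ker t) ν y * HeatKL.logRatio ν μ t y := by
    filter_upwards [Ioi_mem_nhds hs] with t ht using HeatKL.klDiv_heatFlow ht
  refine ((HeatKL.hasDerivAt_normalized_entropy hs hac hKL).congr_of_eventuallyEq h).congr_deriv ?_
  rw [HeatKL.integral_heatFlow hs]
  simp only [HeatKL.norm_fderiv_heatRatio_sq_div hs, integral_div]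
  ring
end
end

section
/- Let φ : (0,∞) → ℝ be a smooth convex function such that 1/φ'' is concave on (0,∞). Then the function (x, y) ↦ φ''(x)·|y|² is jointly convex on (0,∞) × ℝⁿ. -/
open Real

noncomputable section

/-- The derivative of a function that is monotone on an open set is nonnegative there. -/
theorem MonotoneOn.deriv_nonneg_of_isOpen {f : ℝ → ℝ} {s : Set ℝ} (hf : MonotoneOn f s)
    (hs : IsOpen s) {x : ℝ} (hx : x ∈ s) : 0 ≤ deriv f x := by
  rw [← derivWithin_of_isOpen hs hx]
  exact hf.derivWithin_nonneg

/-- A nonnegative concave function on `(0,∞)` vanishing at one point vanishes everywhere. -/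
theorem ConcaveOn.eq_zero_of_nonneg_of_eq_zero {g : ℝ → ℝ} (hg : ConcaveOn ℝ (Set.Ioi 0) g)
    (hnn : ∀ x, 0 < x → 0 ≤ g x) {x w : ℝ} (hx : 0 < x) (hw : 0 < w) (hgx : g x = 0) :
    g w = 0 := by
  have hv : 0 < x ^ 2 / w := by positivity
  have h := hg.2 hv hw (by positivity : 0 ≤ w / (w + x)) (by positivity : 0 ≤ x / (w + x))
    (by field_simp)
  have hcomb : (w / (w + x)) • (x ^ 2 / w) + (x / (w + x)) • w = x := by
    simp only [smul_eq_mul]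
    field_simp
    ring
  rw [hcomb, hgx, smul_eq_mul, smul_eq_mul] at h
  have h₁ : 0 ≤ w / (w + x) * g (x ^ 2 / w) := mul_nonneg (by positivity) (hnn _ hv)
  have hpos : 0 < x / (w + x) := by positivity
  nlinarith [hnn w hw]

/-- The perspective function `(s, u) ↦ s² / u` is jointly convex for `u > 0`. -/
theorem sq_div_convex_combination_le {a b s t u v : ℝ} (ha : 0 ≤ a) (hb : 0 ≤ b)
    (hab : a + b = 1) (hu : 0 < u) (hv : 0 < v) :
    (a * s + b * t) ^ 2 / (a * u + b * v) ≤ a * (s ^ 2 / u) + b * (t ^ 2 / v) := by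
  have hpos : 0 < a * u + b * v := by
    rcases ha.eq_or_lt with rfl | ha'
    · obtain rfl : b = 1 := by linarith
      simpa using hv
    · positivity
  rw [div_le_iff₀ hpos]
  have key : (a * (s ^ 2 / u) + b * (t ^ 2 / v)) * (a * u + b * v) - (a * s + b * t) ^ 2
      = a * b * (s * v - t * u) ^ 2 / (u * v) := by
    field_simp
    ring
  have : 0 ≤ a * b * (s * v - t * u) ^ 2 / (u * v) := by positivity
  linarith

/-- If `φ : (0,∞) → ℝ` is smooth and convex with `1/φ''` concave, then
`(x, y) ↦ φ''(x)·|y|²` is jointly convex on `(0,∞) × ℝⁿ`. -/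
theorem stmt12 {n : ℕ} (φ : ℝ → ℝ)
    (hsmooth : ContDiffOn ℝ (⊤ : ℕ∞) φ (Set.Ioi 0))
    (hconv : ConvexOn ℝ (Set.Ioi 0) φ)
    (hconc : ConcaveOn ℝ (Set.Ioi 0) (fun x => 1 / deriv (deriv φ) x)) :
    ConvexOn ℝ ((Set.Ioi (0 : ℝ)) ×ˢ (Set.univ : Set (EuclideanSpace ℝ (Fin n))))
      (fun p : ℝ × EuclideanSpace ℝ (Fin n) => deriv (deriv φ) p.1 * ‖p.2‖ ^ 2) := by
  have hdiff : ∀ x ∈ Set.Ioi (0 : ℝ), DifferentiableAt ℝ φ x := fun x hx =>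
    (hsmooth.differentiableOn (by simp)).differentiableAt (isOpen_Ioi.mem_nhds hx)
  have hnn : ∀ x, 0 < x → 0 ≤ deriv (deriv φ) x := fun x hx =>
    (hconv.monotoneOn_deriv hdiff).deriv_nonneg_of_isOpen isOpen_Ioi hx
  refine ⟨(convex_Ioi 0).prod convex_univ, ?_⟩
  rintro ⟨x, y⟩ ⟨hx, -⟩ ⟨x', y'⟩ ⟨hx', -⟩ a b ha hb hab
  have hz : 0 < a * x + b * x' := convex_Ioi (0 : ℝ) hx hx' ha hb hab
  have hc := hconc.2 hx hx' ha hb hab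
  simp only [Set.mem_Ioi, Prod.smul_mk, Prod.mk_add_mk, smul_eq_mul] at hx hx' hc ⊢
  by_cases hzero : ∃ w, 0 < w ∧ deriv (deriv φ) w = 0
  · obtain ⟨w, hw, hw0⟩ := hzero
    have hall : ∀ v, 0 < v → deriv (deriv φ) v = 0 := fun v hv => by
      simpa using hconc.eq_zero_of_nonneg_of_eq_zero
        (fun r hr => one_div_nonneg.2 (hnn r hr)) hw hv (by simp [hw0])
    simp [hall _ hx, hall _ hx', hall _ hz]
  · push Not at hzero
    have hpos : ∀ v, 0 < v → 0 < deriv (deriv φ) v := fun v hv =>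
      (hnn v hv).lt_of_ne' (hzero v hv)
    have hu := one_div_pos.2 (hpos x hx)
    have hv := one_div_pos.2 (hpos x' hx')
    have hnorm : ‖a • y + b • y'‖ ≤ a * ‖y‖ + b * ‖y'‖ := by
      simpa [norm_smul, abs_of_nonneg ha, abs_of_nonneg hb] using norm_add_le (a • y) (b • y')
    have hmid : 0 < a * (1 / deriv (deriv φ) x) + b * (1 / deriv (deriv φ) x') :=
      convex_Ioi (0 : ℝ) hu hv ha hb hab
    calc deriv (deriv φ) (a * x + b * x') * ‖a • y + b • y'‖ ^ 2
        = ‖a • y + b • y'‖ ^ 2 / (1 / deriv (deriv φ) (a * x + b * x')) := by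
          rw [one_div, div_inv_eq_mul, mul_comm]
      _ ≤ (a * ‖y‖ + b * ‖y'‖) ^ 2 /
            (a * (1 / deriv (deriv φ) x) + b * (1 / deriv (deriv φ) x')) := by
          gcongr
      _ ≤ a * (‖y‖ ^ 2 / (1 / deriv (deriv φ) x)) +
            b * (‖y'‖ ^ 2 / (1 / deriv (deriv φ) x')) :=
          sq_div_convex_combination_le ha hb hab hu hv
      _ = a * (deriv (deriv φ) x * ‖y‖ ^ 2) + b * (deriv (deriv φ) x' * ‖y'‖ ^ 2) := by
          simp only [one_div, div_inv_eq_mul, mul_comm]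
end
end

section
/- Let μ be a probability measure on ℝⁿ with ∫|x|⁴ dμ(x) < ∞ that satisfies the logarithmic Sobolev inequality with constant C ∈ (0,∞). Then for every probability measure ν on ℝⁿ with D(ν‖μ) < ∞ and every s > 0, D(ν_s‖μ_s) ≤ D(ν‖μ) / (1 + s/C), where μ_s and ν_s are the heat-flow evolutions. In particular, the KL strong data-processing coefficient satisfies η_{KL}(μ,s) ≤ 1/(1 + s/C_{LS}(μ)). -/
open MeasureTheory ProbabilityTheory Real
open scoped ENNReal NNReal

noncomputable section

/-- `μ` satisfies the logarithmic Sobolev inequality with constant `C`. -/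
def LogSobolevIneq {n : ℕ} (μ : Measure (EuclideanSpace ℝ (Fin n))) (C : ℝ) : Prop :=
  ∀ f : EuclideanSpace ℝ (Fin n) → ℝ, LocallyLipschitz f →
    Integrable (fun x => ‖fderiv ℝ f x‖ ^ 2) μ →
    (∫ x, f x ^ 2 ∂μ) = 1 →
    (∫ x, f x ^ 2 * Real.log (f x ^ 2) ∂μ) ≤ 2 * C * ∫ x, ‖fderiv ℝ f x‖ ^ 2 ∂μ

/-- The KL strong data-processing coefficient of `μ` for the Gaussian channel. -/
def etaKL {n : ℕ} (μ : Measure (EuclideanSpace ℝ (Fin n))) (s : ℝ) : ℝ :=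
  sSup {r : ℝ | ∃ ν : Measure (EuclideanSpace ℝ (Fin n)), IsProbabilityMeasure ν ∧
    ν ≪ μ ∧ Integrable (fun x => Real.log (ν.rnDeriv μ x).toReal) ν ∧
    0 < klDiv ν μ ∧ r = klDiv (heatFlow ν s) (heatFlow μ s) / klDiv ν μ}

section KullbackLeibler

open Filter Topology

variable {α : Type*} [MeasurableSpace α] {μ ν : Measure α}

lemma integrable_of_abs_le_const [IsFiniteMeasure μ] {u : α → ℝ} (hu : Measurable u) {M : ℝ}
    (hM : ∀ x, |u x| ≤ M) : Integrable u μ :=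
  .of_bound hu.aestronglyMeasurable M (.of_forall hM)

lemma integrable_exp_of_abs_le_const [IsFiniteMeasure μ] {u : α → ℝ} (hu : Measurable u) {M : ℝ}
    (hM : ∀ x, |u x| ≤ M) : Integrable (fun x => exp (u x)) μ :=
  integrable_of_abs_le_const (M := exp M) hu.exp fun x => by
    rw [abs_of_pos (exp_pos _)]
    exact exp_le_exp.2 (le_of_abs_le (hM x))

lemma klDiv_nonneg [IsProbabilityMeasure μ] [IsProbabilityMeasure ν] (hνμ : ν ≪ μ) :
    0 ≤ klDiv ν μ := by
  have := InformationTheory.toReal_klDiv_of_measure_eq hνμ (by simp)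
  rw [klDiv]
  exact ENNReal.toReal_nonneg.trans_eq this

/-- The easy half of the Donsker–Varadhan variational formula. -/
lemma integral_le_klDiv_add_log_integral_exp [IsProbabilityMeasure μ] [IsProbabilityMeasure ν]
    (hνμ : ν ≪ μ) (hint : Integrable (fun x => log (ν.rnDeriv μ x).toReal) ν)
    {u : α → ℝ} (hu : Measurable u) {M : ℝ} (hM : ∀ x, |u x| ≤ M) :
    ∫ x, u x ∂ν ≤ klDiv ν μ + log (∫ x, exp (u x) ∂μ) := by
  have huν : Integrable u ν := integrable_of_abs_le_const hu hM
  have huμ : Integrable (fun x => exp (u x)) μ := integrable_exp_of_abs_le_const hu hM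
  have := isProbabilityMeasure_tilted huμ
  have hac : ν ≪ μ.tilted u := hνμ.trans (absolutelyContinuous_tilted huμ)
  have key := klDiv_nonneg hac
  have h2 := integral_llr_tilted_right hνμ huν huμ hint
  simp only [llr] at h2
  rw [klDiv, h2] at key
  rw [klDiv]
  linarith

/-- The inequalities `∫ u dν ≤ c + log ∫ exp u dμ` pass to bounded a.e. limits. -/
lemma integral_le_add_log_integral_exp_of_tendsto [IsProbabilityMeasure μ]
    [IsProbabilityMeasure ν] (hνμ : ν ≪ μ) {c M : ℝ} {u : ℕ → α → ℝ} {g : α → ℝ}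
    (hu : ∀ k, Measurable (u k)) (hM : ∀ k x, |u k x| ≤ M)
    (hlim : ∀ᵐ x ∂μ, Tendsto (fun k => u k x) atTop (𝓝 (g x)))
    (h : ∀ k, ∫ x, u k x ∂ν ≤ c + log (∫ x, exp (u k x) ∂μ))
    (hg : Integrable (fun x => exp (g x)) μ) :
    ∫ x, g x ∂ν ≤ c + log (∫ x, exp (g x) ∂μ) := by
  have h1 : Tendsto (fun k => ∫ x, u k x ∂ν) atTop (𝓝 (∫ x, g x ∂ν)) :=
    tendsto_integral_of_dominated_convergence (fun _ => M)
      (fun k => (hu k).aestronglyMeasurable) (integrable_const _)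
      (fun k => .of_forall (hM k)) (hνμ.ae_le hlim)
  have h2 : Tendsto (fun k => ∫ x, exp (u k x) ∂μ) atTop (𝓝 (∫ x, exp (g x) ∂μ)) := by
    refine tendsto_integral_of_dominated_convergence (fun _ => exp M)
      (fun k => (hu k).exp.aestronglyMeasurable) (integrable_const _)
      (fun k => .of_forall fun x => ?_) ?_
    · rw [norm_of_nonneg (exp_pos _).le]
      exact exp_le_exp.2 (le_of_abs_le (hM k x))
    · filter_upwards [hlim] with x hx using (continuous_exp.tendsto _).comp hx
  exact le_of_tendsto_of_tendsto' h1 ((h2.log (integral_exp_pos hg).ne').const_add c) h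

/-- The hard half of the Donsker–Varadhan variational formula, with bounded test functions. -/
lemma klDiv_le_of_forall_measurable [IsProbabilityMeasure μ] [IsProbabilityMeasure ν]
    (hνμ : ν ≪ μ) (hint : Integrable (fun x => log (ν.rnDeriv μ x).toReal) ν) {c : ℝ}
    (h : ∀ (u : α → ℝ) (M : ℝ), Measurable u → (∀ x, |u x| ≤ M) →
      ∫ x, u x ∂ν ≤ c + log (∫ x, exp (u x) ∂μ)) :
    klDiv ν μ ≤ c := by
  set ρ : α → ℝ := fun x => (ν.rnDeriv μ x).toReal with hρ
  have hρm : Measurable ρ := (Measure.measurable_rnDeriv ν μ).ennreal_toReal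
  have hρ0 : ∀ x, 0 ≤ ρ x := fun x => ENNReal.toReal_nonneg
  have hρi : Integrable ρ μ := Measure.integrable_toReal_rnDeriv
  let r : ℕ → α → ℝ := fun k x => max (exp (-k)) (min (ρ x) (exp k))
  have hr0 : ∀ k x, 0 < r k x := fun k x => lt_max_of_lt_left (exp_pos _)
  have hrm : ∀ k, Measurable (r k) := fun k => measurable_const.max (hρm.min measurable_const)
  have hexp : ∀ k x, exp (log (r k x)) = r k x := fun k x => exp_log (hr0 k x)
  have hbd : ∀ (k : ℕ) x, |log (r k x)| ≤ k := by
    intro k x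
    rw [abs_le, ← exp_le_exp, ← exp_le_exp (y := (k : ℝ)), hexp]
    exact ⟨le_max_left _ _, max_le (exp_le_exp.2 (by linarith [k.cast_nonneg (α := ℝ)]))
      (min_le_right _ _)⟩
  have hk : Tendsto (fun k : ℕ => exp (k : ℝ)) atTop atTop :=
    tendsto_exp_atTop.comp tendsto_natCast_atTop_atTop
  have hk' : Tendsto (fun k : ℕ => exp (-(k : ℝ))) atTop (𝓝 0) :=
    tendsto_exp_neg_atTop_nhds_zero.comp tendsto_natCast_atTop_atTop
  have hlim : ∀ x, Tendsto (fun k => r k x) atTop (𝓝 (ρ x)) := by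
    intro x
    have : Tendsto (fun k : ℕ => max (exp (-(k : ℝ))) (ρ x)) atTop (𝓝 (max 0 (ρ x))) :=
      hk'.max tendsto_const_nhds
    rw [max_eq_right (hρ0 x)] at this
    refine this.congr' ?_
    filter_upwards [hk.eventually_ge_atTop (ρ x)] with k hk
    simp only [r, min_eq_left hk]
  have h1 : Tendsto (fun k => ∫ x, log (r k x) ∂ν) atTop (𝓝 (∫ x, log (ρ x) ∂ν)) := by
    refine tendsto_integral_of_dominated_convergence (fun x => |log (ρ x)|)
      (fun k => (hrm k).log.aestronglyMeasurable) hint.abs (fun k => ?_) ?_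
    · filter_upwards [Measure.rnDeriv_pos hνμ, hνμ.ae_le (Measure.rnDeriv_lt_top ν μ)] with x hx hx'
      have hpos : 0 < ρ x := ENNReal.toReal_pos hx.ne' hx'.ne
      have hkk : (0 : ℝ) ≤ k := k.cast_nonneg
      rw [norm_eq_abs, abs_le]
      constructor
      · rw [← exp_le_exp, hexp]
        rcases le_total 0 (log (ρ x)) with h0 | h0
        · rw [abs_of_nonneg h0, exp_neg, exp_log hpos]
          have h1 : 1 ≤ ρ x := by rwa [← exp_zero, ← le_log_iff_exp_le hpos]
          exact (inv_le_one_of_one_le₀ h1).trans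
            (le_max_of_le_right (le_min h1 (one_le_exp hkk)))
        · rw [abs_of_nonpos h0, neg_neg, exp_log hpos]
          have h1 : ρ x ≤ 1 := by rwa [← exp_zero, ← log_le_iff_le_exp hpos]
          exact le_max_of_le_right (le_min le_rfl (h1.trans (one_le_exp hkk)))
      · rw [← exp_le_exp, hexp]
        refine max_le (exp_le_exp.2 (by linarith [abs_nonneg (log (ρ x))]))
          ((min_le_left _ _).trans ?_)
        rw [← log_le_iff_le_exp hpos]
        exact le_abs_self _
    · filter_upwards [Measure.rnDeriv_pos hνμ, hνμ.ae_le (Measure.rnDeriv_lt_top ν μ)] with x hx hx'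
      exact (hlim x).log (ENNReal.toReal_pos hx.ne' hx'.ne).ne'
  have h2 : Tendsto (fun k => ∫ x, r k x ∂μ) atTop (𝓝 1) := by
    have h3 : ∫ x, ρ x ∂μ = 1 := by
      rw [hρ, Measure.integral_toReal_rnDeriv hνμ, probReal_univ]
    rw [← h3]
    refine tendsto_integral_of_dominated_convergence (fun x => ρ x + 1)
      (fun k => (hrm k).aestronglyMeasurable) (hρi.add (integrable_const _))
      (fun k => .of_forall fun x => ?_) (.of_forall hlim)
    rw [norm_of_nonneg (hr0 k x).le]
    exact max_le ((exp_le_one_iff.2 (by simp)).trans (by linarith [hρ0 x]))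
      ((min_le_left _ _).trans (by linarith))
  have h3 : ∀ k, ∫ x, log (r k x) ∂ν ≤ c + log (∫ x, r k x ∂μ) := by
    intro k
    simpa only [hexp] using h _ k (hrm k).log (hbd k)
  have h4 := le_of_tendsto_of_tendsto' h1 ((h2.log one_ne_zero).const_add c) h3
  rwa [log_one, add_zero] at h4

end KullbackLeibler

section Lipschitz

open Filter Topology

/-- A bounded continuous function is the pointwise limit of uniformly bounded Lipschitz
functions. -/
lemma exists_lipschitz_tendsto {X : Type*} [PseudoMetricSpace X] {g : X → ℝ} (hg : Continuous g)
    {M : ℝ} (hM : ∀ x, |g x| ≤ M) :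
    ∃ u : ℕ → X → ℝ, (∀ k, ∃ K, LipschitzWith K (u k)) ∧ (∀ k x, |u k x| ≤ M) ∧
      ∀ x, Tendsto (fun k => u k x) atTop (𝓝 (g x)) := by
  let u : ℕ → X → ℝ := fun k x => ⨅ y, g y + k * dist x y
  have hlow : ∀ (k : ℕ) x y, -M ≤ g y + k * dist x y := fun k x y => by
    have := (abs_le.1 (hM y)).1
    have : 0 ≤ k * dist x y := by positivity
    linarith
  have hbdd : ∀ (k : ℕ) x, BddBelow (Set.range fun y => g y + k * dist x y) := fun k x =>
    ⟨-M, Set.forall_mem_range.2 (hlow k x)⟩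
  have hle : ∀ k x, u k x ≤ g x := fun k x => (ciInf_le (hbdd k x) x).trans (by simp)
  refine ⟨u, fun k => ⟨k, ?_⟩, fun k x => ?_, fun x => ?_⟩
  · refine LipschitzWith.of_le_add_mul _ fun x x' => ?_
    have : Nonempty X := ⟨x⟩
    rw [← sub_le_iff_le_add]
    refine le_ciInf fun y => ?_
    rw [sub_le_iff_le_add]
    refine (ciInf_le (hbdd k x) y).trans ?_
    have h1 := mul_le_mul_of_nonneg_left (dist_triangle x x' y) (k.cast_nonneg (α := ℝ))
    simp only [NNReal.coe_natCast]
    linarith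
  · have : Nonempty X := ⟨x⟩
    exact abs_le.2 ⟨le_ciInf (hlow k x), (hle k x).trans (abs_le.1 (hM x)).2⟩
  · have : Nonempty X := ⟨x⟩
    rw [Metric.tendsto_atTop]
    intro ε hε
    obtain ⟨δ, hδ, hδg⟩ := Metric.continuous_iff.1 hg x (ε / 2) (half_pos hε)
    obtain ⟨N, hN⟩ := exists_nat_ge (2 * M / δ)
    refine ⟨N, fun k hk => ?_⟩
    have hk' : 2 * M ≤ k * δ := by
      rw [← div_le_iff₀ hδ]
      exact hN.trans (Nat.cast_le.2 hk)
    have h1 : g x - ε / 2 ≤ u k x := by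
      refine le_ciInf fun y => ?_
      rcases lt_or_ge (dist y x) δ with h | h
      · have := (abs_lt.1 (Real.dist_eq _ _ ▸ hδg y h)).1
        have : 0 ≤ k * dist x y := by positivity
        linarith
      · have h2 : k * δ ≤ k * dist x y :=
          mul_le_mul_of_nonneg_left (dist_comm x y ▸ h) k.cast_nonneg
        have := (abs_le.1 (hM x)).2
        have := (abs_le.1 (hM y)).1
        linarith
    rw [Real.dist_eq, abs_lt]
    constructor <;> linarith [hle k x]

/-- The hard half of the Donsker–Varadhan variational formula, with bounded Lipschitz test
functions. -/
lemma klDiv_le_of_forall_lipschitz {X : Type*} [MetricSpace X] [MeasurableSpace X] [BorelSpace X]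
    {μ ν : Measure X} [IsProbabilityMeasure μ] [IsProbabilityMeasure ν]
    (hνμ : ν ≪ μ) (hint : Integrable (fun x => log (ν.rnDeriv μ x).toReal) ν) {c : ℝ}
    (h : ∀ (u : X → ℝ) (M : ℝ) (K : ℝ≥0), LipschitzWith K u → (∀ x, |u x| ≤ M) →
      ∫ x, u x ∂ν ≤ c + log (∫ x, exp (u x) ∂μ)) :
    klDiv ν μ ≤ c := by
  have hcont : ∀ (u : X → ℝ) (M : ℝ), Continuous u → (∀ x, |u x| ≤ M) →
      ∫ x, u x ∂ν ≤ c + log (∫ x, exp (u x) ∂μ) := by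
    intro g M hg hM
    obtain ⟨u, hu, huM, hlim⟩ := exists_lipschitz_tendsto hg hM
    refine integral_le_add_log_integral_exp_of_tendsto hνμ
      (fun k => (hu k).choose_spec.continuous.measurable) huM (.of_forall hlim) (fun k => ?_)
      (integrable_exp_of_abs_le_const hg.measurable hM)
    exact h _ M _ (hu k).choose_spec (huM k)
  refine klDiv_le_of_forall_measurable hνμ hint fun g M hg hM => ?_
  have hgi : Integrable g μ := integrable_of_abs_le_const hg hM
  choose v hv hvi using fun j : ℕ =>
    hgi.exists_boundedContinuous_integral_sub_le (ε := 1 / (j + 1)) Nat.one_div_pos_of_nat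
  have hmeas : TendstoInMeasure μ (fun j => ⇑(v j)) atTop g := by
    refine tendstoInMeasure_of_tendsto_eLpNorm one_ne_zero
      (fun j => (hvi j).aestronglyMeasurable) hgi.aestronglyMeasurable ?_
    have h1 : Tendsto (fun j : ℕ => ENNReal.ofReal (1 / ((j : ℝ) + 1))) atTop (𝓝 0) := by
      simpa using ENNReal.tendsto_ofReal tendsto_one_div_add_atTop_nhds_zero_nat
    refine tendsto_of_tendsto_of_tendsto_of_le_of_le tendsto_const_nhds h1
      (fun _ => zero_le) fun j => ?_
    simp only
    rw [eLpNorm_sub_comm, eLpNorm_one_eq_lintegral_enorm]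
    have := ofReal_integral_norm_eq_lintegral_enorm (hgi.sub (hvi j))
    rw [← this]
    exact ENNReal.ofReal_le_ofReal (hv j)
  obtain ⟨ns, -, hns⟩ := hmeas.exists_seq_tendsto_ae
  have hclip : ∀ a b : ℝ, 0 ≤ b → |max (-b) (min a b)| ≤ b := fun a b hb =>
    abs_le.2 ⟨le_max_left _ _, max_le (by linarith) (min_le_right _ _)⟩
  have hM0 : 0 ≤ M := by
    obtain ⟨x⟩ := nonempty_of_isProbabilityMeasure μ
    exact (abs_nonneg _).trans (hM x)
  refine integral_le_add_log_integral_exp_of_tendsto (M := M) hνμ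
    (u := fun i x => max (-M) (min (v (ns i) x) M)) (fun i => ?_) (fun i x => hclip _ _ hM0) ?_
    (fun i => ?_) (integrable_exp_of_abs_le_const hg hM)
  · exact (continuous_const.max ((v (ns i)).continuous.min continuous_const)).measurable
  · filter_upwards [hns] with x hx
    have h1 := (tendsto_const_nhds (x := -M)).max (hx.min (tendsto_const_nhds (x := M)))
    rwa [min_eq_left (abs_le.1 (hM x)).2, max_eq_right (abs_le.1 (hM x)).1] at h1
  · exact hcont _ M (continuous_const.max ((v (ns i)).continuous.min continuous_const))
      fun x => hclip _ _ hM0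

end Lipschitz

section HeatFlow

open scoped RealInnerProductSpace

variable {n : ℕ}

/-- The density of the standard Gaussian measure on ℝⁿ. -/
def stdGaussianDensity (n : ℕ) (x : EuclideanSpace ℝ (Fin n)) : ℝ :=
  (2 * π) ^ (-(n : ℝ) / 2) * exp (-‖x‖ ^ 2 / 2)

lemma stdGaussianDensity_nonneg (x : EuclideanSpace ℝ (Fin n)) : 0 ≤ stdGaussianDensity n x := by
  unfold stdGaussianDensity
  positivity

lemma stdGaussianDensity_neg (x : EuclideanSpace ℝ (Fin n)) :
    stdGaussianDensity n (-x) = stdGaussianDensity n x := by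
  simp [stdGaussianDensity]

lemma stdGaussianDensity_sub (x a : EuclideanSpace ℝ (Fin n)) :
    stdGaussianDensity n (x - a) = stdGaussianDensity n x * exp (⟪x, a⟫ - ‖a‖ ^ 2 / 2) := by
  rw [stdGaussianDensity, stdGaussianDensity, mul_assoc, ← exp_add, norm_sub_sq_real]
  ring_nf

@[fun_prop]
lemma continuous_stdGaussianDensity : Continuous (stdGaussianDensity n) := by
  unfold stdGaussianDensity
  fun_prop

lemma integral_stdGaussianDensity : ∫ x, stdGaussianDensity n x = 1 := by
  have h := GaussianFourier.integral_rexp_neg_mul_sq_norm (V := EuclideanSpace ℝ (Fin n))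
    (b := 1 / 2) (by norm_num)
  have h2 : (fun x : EuclideanSpace ℝ (Fin n) => stdGaussianDensity n x) =
      fun x => (2 * π) ^ (-(n : ℝ) / 2) * exp (-(1 / 2) * ‖x‖ ^ 2) := by
    ext x
    rw [stdGaussianDensity]
    ring_nf
  rw [h2, integral_const_mul, h, finrank_euclideanSpace_fin,
    show π / (1 / 2) = 2 * π by ring, ← rpow_add (by positivity)]
  rw [neg_div, neg_add_cancel, rpow_zero]

lemma integrable_stdGaussianDensity : Integrable (stdGaussianDensity n) :=
  .of_integral_ne_zero (by rw [integral_stdGaussianDensity]; exact one_ne_zero)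

lemma stdGaussian_eq_withDensity :
    _root_.stdGaussian n = volume.withDensity fun x => ENNReal.ofReal (stdGaussianDensity n x) :=
  rfl

instance : IsProbabilityMeasure (_root_.stdGaussian n) := by
  constructor
  rw [stdGaussian_eq_withDensity, withDensity_apply _ MeasurableSet.univ, setLIntegral_univ,
    ← ofReal_integral_eq_lintegral_ofReal integrable_stdGaussianDensity
      (.of_forall stdGaussianDensity_nonneg), integral_stdGaussianDensity, ENNReal.ofReal_one]

lemma integral_stdGaussian (f : EuclideanSpace ℝ (Fin n) → ℝ) :
    ∫ x, f x ∂(_root_.stdGaussian n) = ∫ x, stdGaussianDensity n x * f x := by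
  rw [stdGaussian_eq_withDensity, integral_withDensity_eq_integral_toReal_smul
    (by fun_prop) (by simp)]
  simp [stdGaussianDensity_nonneg]

lemma integrable_stdGaussian_iff {f : EuclideanSpace ℝ (Fin n) → ℝ} :
    Integrable f (_root_.stdGaussian n) ↔ Integrable fun x => stdGaussianDensity n x * f x := by
  rw [stdGaussian_eq_withDensity, integrable_withDensity_iff_integrable_smul'
    (by fun_prop) (by simp)]
  simp [stdGaussianDensity_nonneg]

/-- Cameron–Martin formula. -/
lemma integral_stdGaussian_add (f : EuclideanSpace ℝ (Fin n) → ℝ)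
    (a : EuclideanSpace ℝ (Fin n)) :
    ∫ x, f (x + a) ∂(_root_.stdGaussian n) =
      ∫ x, exp (⟪x, a⟫ - ‖a‖ ^ 2 / 2) * f x ∂(_root_.stdGaussian n) := by
  rw [integral_stdGaussian, integral_stdGaussian,
    ← integral_sub_right_eq_self (fun x => stdGaussianDensity n x * f (x + a)) a]
  simp [stdGaussianDensity_sub, mul_assoc]

lemma integrable_exp_inner_mul_stdGaussian {f : EuclideanSpace ℝ (Fin n) → ℝ}
    {a : EuclideanSpace ℝ (Fin n)}
    (hf : Integrable (fun x => f (x + a)) (_root_.stdGaussian n)) :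
    Integrable (fun x => exp (⟪x, a⟫ - ‖a‖ ^ 2 / 2) * f x) (_root_.stdGaussian n) := by
  rw [integrable_stdGaussian_iff] at hf ⊢
  have := hf.comp_sub_right a
  simpa [stdGaussianDensity_sub, mul_assoc] using this

lemma integrable_inner_stdGaussian (a : EuclideanSpace ℝ (Fin n)) :
    Integrable (fun x => ⟪x, a⟫) (_root_.stdGaussian n) := by
  have h : ∀ b : EuclideanSpace ℝ (Fin n),
      Integrable (fun x => exp ⟪x, b⟫) (_root_.stdGaussian n) := fun b => by
    have := (integrable_exp_inner_mul_stdGaussian (f := fun _ => 1) (a := b)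
      (integrable_const 1)).const_mul (exp (‖b‖ ^ 2 / 2))
    refine this.congr (.of_forall fun x => ?_)
    simp only [mul_one]
    rw [← exp_add]
    ring_nf
  refine ((h a).add (h (-a))).mono' (by fun_prop) (.of_forall fun x => ?_)
  simp only [Pi.add_apply, inner_neg_right, norm_eq_abs]
  refine abs_le.2 ⟨?_, ?_⟩ <;>
    nlinarith [add_one_le_exp (⟪x, a⟫), add_one_le_exp (-⟪x, a⟫), exp_pos ⟪x, a⟫, exp_pos (-⟪x, a⟫)]

lemma integral_inner_stdGaussian (a : EuclideanSpace ℝ (Fin n)) :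
    ∫ x, ⟪x, a⟫ ∂(_root_.stdGaussian n) = 0 := by
  have h : ∫ x, ⟪x, a⟫ ∂(_root_.stdGaussian n) = -∫ x, ⟪x, a⟫ ∂(_root_.stdGaussian n) := by
    conv_lhs => rw [integral_stdGaussian,
      ← integral_neg_eq_self (fun x => stdGaussianDensity n x * ⟪x, a⟫)]
    rw [integral_stdGaussian, ← integral_neg]
    simp [stdGaussianDensity_neg]
  linarith

/-- The log-Harnack inequality for Gaussian averages. -/
lemma integral_le_log_integral_exp_add_stdGaussian {h : EuclideanSpace ℝ (Fin n) → ℝ}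
    (hh : Measurable h) {M : ℝ} (hM : ∀ x, |h x| ≤ M) (a : EuclideanSpace ℝ (Fin n)) :
    ∫ x, h x ∂(_root_.stdGaussian n) ≤
      log (∫ x, exp (h (x + a)) ∂(_root_.stdGaussian n)) + ‖a‖ ^ 2 / 2 := by
  have hi : Integrable h (_root_.stdGaussian n) := integrable_of_abs_le_const hh hM
  have hia : Integrable (fun x => ⟪x, a⟫ - ‖a‖ ^ 2 / 2) (_root_.stdGaussian n) :=
    (integrable_inner_stdGaussian a).sub (integrable_const _)
  have he : Integrable (fun x => exp (h (x + a))) (_root_.stdGaussian n) :=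
    integrable_exp_of_abs_le_const (u := fun x => h (x + a)) (by fun_prop) (fun x => hM (x + a))
  have hj := integrable_exp_inner_mul_stdGaussian (f := fun x => exp (h x)) he
  rw [integral_stdGaussian_add (fun x => exp (h x)) a]
  simp only [← exp_add] at hj ⊢
  have jensen := convexOn_exp.map_integral_le continuous_exp.continuousOn isClosed_univ
    (.of_forall fun _ => Set.mem_univ _) (hia.add hi) hj
  have h1 : ∫ x, (⟪x, a⟫ - ‖a‖ ^ 2 / 2 + h x) ∂(_root_.stdGaussian n) =
      ∫ x, h x ∂(_root_.stdGaussian n) - ‖a‖ ^ 2 / 2 := by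
    rw [integral_add hia hi, integral_sub (integrable_inner_stdGaussian a) (integrable_const _),
      integral_inner_stdGaussian]
    simp
    ring
  simp only [Pi.add_apply] at jensen
  rw [h1] at jensen
  have := (le_log_iff_exp_le (integral_exp_pos hj)).2 jensen
  linarith

lemma measurable_heatFlow_map (s : ℝ) :
    Measurable fun p : EuclideanSpace ℝ (Fin n) × EuclideanSpace ℝ (Fin n) =>
      p.1 + Real.sqrt s • p.2 := by
  fun_prop

instance (μ : Measure (EuclideanSpace ℝ (Fin n))) [IsProbabilityMeasure μ] (s : ℝ) :
    IsProbabilityMeasure (heatFlow μ s) :=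
  Measure.isProbabilityMeasure_map (measurable_heatFlow_map s).aemeasurable

lemma heatFlow_absolutelyContinuous {μ ν : Measure (EuclideanSpace ℝ (Fin n))}
    [IsProbabilityMeasure μ] (h : ν ≪ μ) (s : ℝ) : heatFlow ν s ≪ heatFlow μ s :=
  (h.prod Measure.AbsolutelyContinuous.rfl).map (measurable_heatFlow_map s)

lemma integral_heatFlow (μ : Measure (EuclideanSpace ℝ (Fin n))) [IsProbabilityMeasure μ] (s : ℝ)
    {g : EuclideanSpace ℝ (Fin n) → ℝ} (hg : Measurable g) {M : ℝ} (hM : ∀ x, |g x| ≤ M) :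
    ∫ x, g x ∂(heatFlow μ s) =
      ∫ x, ∫ z, g (x + Real.sqrt s • z) ∂(_root_.stdGaussian n) ∂μ := by
  rw [heatFlow, integral_map (measurable_heatFlow_map s).aemeasurable hg.aestronglyMeasurable]
  exact integral_prod _ (integrable_of_abs_le_const (hg.comp (measurable_heatFlow_map s))
    fun p => hM _)

/-- Gaussian averages preserve Lipschitz constants after taking `log ∫ exp`. -/
lemma lipschitzWith_log_integral_exp {g : EuclideanSpace ℝ (Fin n) → ℝ} {K : ℝ≥0}
    (hg : LipschitzWith K g) {M : ℝ} (hM : ∀ x, |g x| ≤ M) (r : ℝ) :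
    LipschitzWith K fun x => log (∫ z, exp (g (x + r • z)) ∂(_root_.stdGaussian n)) := by
  have hm := hg.continuous.measurable
  have hi : ∀ x, Integrable (fun z => exp (g (x + r • z))) (_root_.stdGaussian n) := fun x =>
    integrable_exp_of_abs_le_const (u := fun z => g (x + r • z)) (by fun_prop) (fun z => hM _)
  refine LipschitzWith.of_le_add_mul _ fun x y => ?_
  rw [← log_exp (K * dist x y), ← log_mul (integral_exp_pos (hi y)).ne' (exp_pos _).ne']
  refine log_le_log (integral_exp_pos (hi x)) ?_
  rw [← integral_mul_const]
  refine integral_mono (hi x) ((hi y).mul_const _) fun z => ?_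
  simp only
  rw [← exp_add, exp_le_exp]
  have := hg.le_add_mul (x + r • z) (y + r • z)
  rwa [dist_add_right] at this

lemma abs_log_integral_exp_le {α : Type*} [MeasurableSpace α] {μ : Measure α}
    [IsProbabilityMeasure μ] {u : α → ℝ} (hu : Measurable u) {M : ℝ} (hM : ∀ x, |u x| ≤ M) :
    |log (∫ x, exp (u x) ∂μ)| ≤ M := by
  have hi : Integrable (fun x => exp (u x)) μ := integrable_exp_of_abs_le_const hu hM
  have hpos := integral_exp_pos hi
  rw [abs_le, le_log_iff_exp_le hpos, log_le_iff_le_exp hpos]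
  constructor
  · simpa using integral_mono (μ := μ) (integrable_const (exp (-M))) hi fun x =>
      exp_le_exp.2 (abs_le.1 (hM x)).1
  · simpa using integral_mono (μ := μ) hi (integrable_const (exp M)) fun x =>
      exp_le_exp.2 (abs_le.1 (hM x)).2

end HeatFlow

section HopfLax

open Filter Topology
open scoped RealInnerProductSpace

section Semigroup

variable {E : Type*} [NormedAddCommGroup E] [InnerProductSpace ℝ E]

/-- The Hopf–Lax semigroup `Q_t f x = inf_y f y + ‖y - x‖² / (2t)`, parametrized by
`y = x + t z`. -/
def hopfLax (f : E → ℝ) (t : ℝ) (x : E) : ℝ :=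
  ⨅ z, f (x + t • z) + t * ‖z‖ ^ 2 / 2

variable {f : E → ℝ} {M : ℝ} {K : ℝ≥0} {t h : ℝ}

lemma neg_le_hopfLax_integrand (hM : ∀ x, |f x| ≤ M) (ht : 0 ≤ t) (x z : E) :
    -M ≤ f (x + t • z) + t * ‖z‖ ^ 2 / 2 := by
  have h1 := (abs_le.1 (hM (x + t • z))).1
  have h2 : 0 ≤ t * ‖z‖ ^ 2 / 2 := by positivity
  linarith

lemma hopfLax_le (hM : ∀ x, |f x| ≤ M) (ht : 0 ≤ t) (x z : E) :
    hopfLax f t x ≤ f (x + t • z) + t * ‖z‖ ^ 2 / 2 :=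
  ciInf_le ⟨-M, Set.forall_mem_range.2 (neg_le_hopfLax_integrand hM ht x)⟩ z

lemma hopfLax_zero (f : E → ℝ) : hopfLax f 0 = f := by
  ext x
  simp [hopfLax]

lemma abs_hopfLax_le (hM : ∀ x, |f x| ≤ M) (ht : 0 ≤ t) (x : E) : |hopfLax f t x| ≤ M :=
  abs_le.2 ⟨le_ciInf (neg_le_hopfLax_integrand hM ht x),
    (hopfLax_le hM ht x 0).trans (by simpa using le_of_abs_le (hM x))⟩

lemma lipschitzWith_hopfLax (hK : LipschitzWith K f) (hM : ∀ x, |f x| ≤ M) (ht : 0 ≤ t) :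
    LipschitzWith K (hopfLax f t) := by
  refine LipschitzWith.of_le_add_mul _ fun x y => ?_
  rw [← sub_le_iff_le_add]
  refine le_ciInf fun z => ?_
  have h1 := hK.le_add_mul (x + t • z) (y + t • z)
  rw [dist_add_right] at h1
  linarith [hopfLax_le hM ht x z]

lemma hopfLax_add_le (hM : ∀ x, |f x| ≤ M) (ht : 0 ≤ t) (hh : 0 < h) (x v : E) :
    hopfLax f (t + h) x ≤ hopfLax f t (x - h • v) + h * ‖v‖ ^ 2 / 2 := by
  rw [← sub_le_iff_le_add]
  refine le_ciInf fun z => ?_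
  have hth : 0 < t + h := by linarith
  have h1 := hopfLax_le hM hth.le x ((t + h)⁻¹ • (t • z - h • v))
  rw [smul_inv_smul₀ hth.ne', norm_smul, mul_pow, norm_inv, norm_of_nonneg hth.le] at h1
  have h2 : (t + h) * ((t + h)⁻¹ ^ 2 * ‖t • z - h • v‖ ^ 2) ≤ t * ‖z‖ ^ 2 + h * ‖v‖ ^ 2 := by
    have h3 : (t + h) * ((t + h)⁻¹ ^ 2 * ‖t • z - h • v‖ ^ 2) = ‖t • z - h • v‖ ^ 2 / (t + h) := by
      field_simp
    rw [h3, div_le_iff₀ hth, norm_sub_sq_real, norm_smul, norm_smul, norm_of_nonneg ht,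
      norm_of_nonneg hh.le, real_inner_smul_left, real_inner_smul_right]
    have h4 : 0 ≤ t * h * ‖z + v‖ ^ 2 := by positivity
    rw [norm_add_sq_real] at h4
    linarith
  rw [show x - h • v + t • z = x + (t • z - h • v) by abel]
  linarith

lemma hopfLax_le_hopfLax_add (hK : LipschitzWith K f) (hM : ∀ x, |f x| ≤ M) (ht : 0 ≤ t)
    (hh : 0 ≤ h) (x : E) : hopfLax f t x ≤ hopfLax f (t + h) x + h * (K ^ 2 / 2) := by
  rw [← sub_le_iff_le_add]
  refine le_ciInf fun z => ?_
  have h1 := hopfLax_le hM ht x z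
  have h2 := hK.le_add_mul (x + t • z) (x + (t + h) • z)
  rw [dist_eq_norm, show x + t • z - (x + (t + h) • z) = -(h • z) by rw [add_smul]; abel,
    norm_neg, norm_smul, norm_of_nonneg hh] at h2
  have h3 : 0 ≤ h * (K - ‖z‖) ^ 2 := by positivity
  linarith

lemma continuousOn_hopfLax (hK : LipschitzWith K f) (hM : ∀ x, |f x| ≤ M) (x : E) :
    ContinuousOn (fun t => hopfLax f t x) (Set.Ici 0) := by
  have key : ∀ s ∈ Set.Ici (0 : ℝ), ∀ t ∈ Set.Ici (0 : ℝ), s ≤ t →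
      dist (hopfLax f s x) (hopfLax f t x) ≤ (K ^ 2 / 2) * dist s t := by
    intro s hs t ht hst
    rw [Real.dist_eq, Real.dist_eq, abs_sub_comm s t, abs_of_nonneg (sub_nonneg.2 hst)]
    have h1 := hopfLax_le_hopfLax_add hK hM hs (sub_nonneg.2 hst) x
    rw [add_sub_cancel] at h1
    have h2 : hopfLax f t x ≤ hopfLax f s x := by
      rcases hst.eq_or_lt with rfl | hlt
      · exact le_rfl
      · have := hopfLax_add_le hM hs (sub_pos.2 hlt) x 0
        simpa using this
    rw [abs_of_nonneg (sub_nonneg.2 h2)]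
    linarith
  refine (LipschitzOnWith.of_dist_le_mul (K := K ^ 2 / 2) fun s hs t ht => ?_).continuousOn
  rcases le_total s t with hst | hst
  · simpa using key s hs t ht hst
  · simpa [dist_comm] using key t ht s hs hst

end Semigroup

lemma abs_exp_sub_exp_le {a b c : ℝ} (ha : a ≤ c) (hb : b ≤ c) :
    |exp a - exp b| ≤ exp c * |a - b| := by
  have key : ∀ a b : ℝ, a ≤ c → exp a - exp b ≤ exp c * |a - b| := fun a b ha => by
    have h1 : exp b = exp a * exp (b - a) := by rw [← exp_add]; ring_nf
    have h2 := mul_le_mul_of_nonneg_left (add_one_le_exp (b - a)) (exp_pos a).le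
    have h3 := mul_le_mul_of_nonneg_left (le_abs_self (a - b)) (exp_pos a).le
    have h4 := mul_le_mul_of_nonneg_right (exp_le_exp.2 ha) (abs_nonneg (a - b))
    linarith
  refine abs_le.2 ⟨?_, key a b ha⟩
  have := key b a hb
  rw [abs_sub_comm] at this
  linarith

variable {n : ℕ} {μ : Measure (EuclideanSpace ℝ (Fin n))} {w : EuclideanSpace ℝ (Fin n) → ℝ}
  {M : ℝ} {K : ℝ≥0}

lemma norm_gradient_le (hK : LipschitzWith K w) (x : EuclideanSpace ℝ (Fin n)) :
    ‖gradient w x‖ ≤ K := by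
  rw [gradient, LinearIsometryEquiv.norm_map]
  exact norm_fderiv_le_of_lipschitz ℝ hK

lemma measurable_gradient : Measurable (gradient w) :=
  (InnerProductSpace.toDual ℝ _).symm.continuous.measurable.comp (measurable_fderiv ℝ w)

/-- One explicit gradient step for the Hamilton–Jacobi equation `∂ₜw + ‖∇w‖²/2 = 0`. -/
def gradientStep (w : EuclideanSpace ℝ (Fin n) → ℝ) (h : ℝ) (x : EuclideanSpace ℝ (Fin n)) : ℝ :=
  w (x - h • gradient w x) + h * ‖gradient w x‖ ^ 2 / 2

lemma gradientStep_zero : gradientStep w 0 = w := by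
  ext x
  simp [gradientStep]

lemma measurable_gradientStep (hw : Measurable w) (h : ℝ) : Measurable (gradientStep w h) := by
  have := measurable_gradient (w := w)
  unfold gradientStep
  fun_prop

lemma hasDerivAt_gradientStep (x : EuclideanSpace ℝ (Fin n)) :
    HasDerivAt (fun h => gradientStep w h x) (-(‖gradient w x‖ ^ 2 / 2)) 0 := by
  by_cases hx : DifferentiableAt ℝ w x
  · have h1 : HasDerivAt (fun h : ℝ => x - h • gradient w x) (-gradient w x) 0 := by
      simpa using ((hasDerivAt_id (0 : ℝ)).smul_const (gradient w x)).const_sub x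
    have h2 : HasDerivAt (fun h : ℝ => w (x - h • gradient w x))
        (fderiv ℝ w x (-gradient w x)) 0 := by
      have h3 : HasFDerivAt w (fderiv ℝ w x) (x - (0 : ℝ) • gradient w x) := by
        simpa using hx.hasFDerivAt
      exact h3.comp_hasDerivAt (0 : ℝ) h1
    have h4 : HasDerivAt (fun h : ℝ => h * ‖gradient w x‖ ^ 2 / 2) (‖gradient w x‖ ^ 2 / 2) 0 := by
      simpa using ((hasDerivAt_id (0 : ℝ)).mul_const (‖gradient w x‖ ^ 2)).div_const 2
    have h5 : fderiv ℝ w x (gradient w x) = ‖gradient w x‖ ^ 2 := by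
      rw [← real_inner_self_eq_norm_sq]
      conv_rhs => rw [gradient]
      rw [InnerProductSpace.toDual_symm_apply]
      rfl
    refine (h2.add h4).congr_deriv ?_
    rw [map_neg, h5]
    ring
  · have h0 : gradient w x = 0 := by simp [gradient, fderiv_zero_of_not_differentiableAt hx]
    simpa [gradientStep, h0] using hasDerivAt_const (0 : ℝ) (w x)

lemma abs_gradientStep_sub_le (hK : LipschitzWith K w) (x : EuclideanSpace ℝ (Fin n))
    (h h' : ℝ) : |gradientStep w h x - gradientStep w h' x| ≤ 3 / 2 * K ^ 2 * |h - h'| := by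
  have hg := norm_gradient_le hK x
  have h1 := hK.dist_le_mul (x - h • gradient w x) (x - h' • gradient w x)
  rw [dist_sub_left, dist_eq_norm (h • _), ← sub_smul, norm_smul, norm_eq_abs, Real.dist_eq] at h1
  have h2 : K * (|h - h'| * ‖gradient w x‖) ≤ K ^ 2 * |h - h'| := by
    have : K * (|h - h'| * ‖gradient w x‖) ≤ K * (|h - h'| * K) := by gcongr
    linarith
  have h3 : |(h - h') * ‖gradient w x‖ ^ 2 / 2| ≤ K ^ 2 / 2 * |h - h'| := by
    rw [abs_div, abs_mul, abs_of_nonneg (sq_nonneg ‖gradient w x‖), abs_two]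
    have : |h - h'| * ‖gradient w x‖ ^ 2 ≤ |h - h'| * K ^ 2 := by gcongr
    linarith
  have h4 : gradientStep w h x - gradientStep w h' x =
      (w (x - h • gradient w x) - w (x - h' • gradient w x)) +
        (h - h') * ‖gradient w x‖ ^ 2 / 2 := by
    unfold gradientStep
    ring
  rw [h4]
  refine (abs_add_le _ _).trans ?_
  linarith

lemma hasDerivAt_integral_exp_gradientStep [IsProbabilityMeasure μ] (hK : LipschitzWith K w)
    (hM : ∀ x, |w x| ≤ M) {p q : ℝ} (hp : 0 ≤ p) (hq : 0 ≤ q) :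
    HasDerivAt (fun h => ∫ x, exp ((p + q * h) * gradientStep w h x) ∂μ)
      (∫ x, exp (p * w x) * (q * w x - p * (‖gradient w x‖ ^ 2 / 2)) ∂μ) 0 := by
  have hwm := hK.continuous.measurable
  have hgm := measurable_gradient (w := w)
  set A : ℝ := M + 3 / 2 * K ^ 2 with hAdef
  have hA : ∀ h ∈ Metric.ball (0 : ℝ) 1, ∀ x, |gradientStep w h x| ≤ A := by
    intro h hh x
    have h1 := abs_gradientStep_sub_le hK x h 0
    rw [gradientStep_zero, sub_zero] at h1
    have h2 : |h| ≤ 1 := by simpa using (Metric.mem_ball.1 hh).le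
    have h3 : 3 / 2 * (K : ℝ) ^ 2 * |h| ≤ 3 / 2 * (K : ℝ) ^ 2 * 1 := by gcongr
    have h4 := abs_add_le (gradientStep w h x - w x) (w x)
    rw [sub_add_cancel] at h4
    rw [hAdef]
    linarith [hM x]
  have hpq : ∀ h ∈ Metric.ball (0 : ℝ) 1, |p + q * h| ≤ p + q := by
    intro h hh
    have h2 : |h| ≤ 1 := by simpa using (Metric.mem_ball.1 hh).le
    refine (abs_add_le _ _).trans ?_
    rw [abs_mul, abs_of_nonneg hp, abs_of_nonneg hq]
    nlinarith
  set B : ℝ := (p + q) * A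
  have hB : ∀ h ∈ Metric.ball (0 : ℝ) 1, ∀ x, (p + q * h) * gradientStep w h x ≤ B := by
    intro h hh x
    refine (le_abs_self _).trans ?_
    rw [abs_mul]
    exact mul_le_mul (hpq h hh) (hA h hh x) (abs_nonneg _) (by positivity)
  refine (hasDerivAt_integral_of_dominated_loc_of_lip
    (bound := fun _ => exp B * ((p + q) * (3 / 2 * K ^ 2) + q * A))
    (Metric.ball_mem_nhds (0 : ℝ) one_pos) (.of_forall fun h => ?_) ?_ ?_ (.of_forall fun x => ?_)
    (integrable_const _) (.of_forall fun x => ?_)).2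
  · exact ((measurable_gradientStep hwm h).const_mul _).exp.aestronglyMeasurable
  · simp only [mul_zero, add_zero, gradientStep_zero]
    refine integrable_exp_of_abs_le_const (M := p * M) (hwm.const_mul p) fun x => ?_
    rw [abs_mul, abs_of_nonneg hp]
    exact mul_le_mul_of_nonneg_left (hM x) hp
  · exact (by fun_prop : Measurable _).aestronglyMeasurable
  · refine LipschitzOnWith.of_dist_le_mul fun h hh h' hh' => ?_
    have hA0 : 0 ≤ A := (abs_nonneg _).trans (hA h hh x)
    rw [Real.coe_nnabs, abs_of_nonneg (by positivity), Real.dist_eq, Real.dist_eq]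
    refine (abs_exp_sub_exp_le (hB h hh x) (hB h' hh' x)).trans ?_
    rw [mul_assoc]
    refine mul_le_mul_of_nonneg_left ?_ (exp_pos _).le
    have h1 : (p + q * h) * gradientStep w h x - (p + q * h') * gradientStep w h' x =
        (p + q * h) * (gradientStep w h x - gradientStep w h' x) +
          q * (gradientStep w h' x * (h - h')) := by ring
    rw [h1, add_mul ((p + q) * _) (q * A)]
    refine (abs_add_le _ _).trans (add_le_add ?_ ?_)
    · rw [abs_mul, mul_assoc (p + q)]
      exact mul_le_mul (hpq h hh) (abs_gradientStep_sub_le hK x h h') (abs_nonneg _) (by positivity)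
    · rw [abs_mul, abs_mul, abs_of_nonneg hq, mul_assoc]
      gcongr
      exact hA h' hh' x
  · have h1 : HasDerivAt (fun h : ℝ => p + q * h) q 0 := by
      simpa using ((hasDerivAt_id (0 : ℝ)).const_mul q).const_add p
    have h2 := (h1.mul (hasDerivAt_gradientStep (w := w) x)).exp
    refine h2.congr_deriv ?_
    simp only [mul_zero, add_zero, gradientStep_zero, Pi.mul_apply]
    ring

/-- The logarithmic Sobolev inequality in exponential form. -/
lemma LogSobolevIneq.exp_form [IsProbabilityMeasure μ] {C : ℝ} (hLS : LogSobolevIneq μ C)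
    (hK : LipschitzWith K w) (hM : ∀ x, |w x| ≤ M) {p : ℝ} (hp : 0 < p) :
    ∫ x, exp (p * w x) * (p * w x) ∂μ
        - (∫ x, exp (p * w x) ∂μ) * log (∫ x, exp (p * w x) ∂μ) ≤
      C * p ^ 2 / 2 * ∫ x, exp (p * w x) * ‖gradient w x‖ ^ 2 ∂μ := by
  have hwm := hK.continuous.measurable
  have hgm := measurable_gradient (w := w)
  have hpM : ∀ x, |p * w x| ≤ p * M := fun x => by
    rw [abs_mul, abs_of_pos hp]
    exact mul_le_mul_of_nonneg_left (hM x) hp.le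
  have hi : Integrable (fun x => exp (p * w x)) μ :=
    integrable_exp_of_abs_le_const (hwm.const_mul p) hpM
  have hiw : Integrable (fun x => exp (p * w x) * (p * w x)) μ :=
    hi.mul_bdd (hwm.const_mul p).aestronglyMeasurable (.of_forall hpM)
  have hig : Integrable (fun x => exp (p * w x) * ‖gradient w x‖ ^ 2) μ := by
    refine hi.mul_bdd (c := K ^ 2) (by fun_prop : Measurable _).aestronglyMeasurable
      (.of_forall fun x => ?_)
    rw [norm_pow, norm_norm]
    gcongr
    exact norm_gradient_le hK x
  set Z := ∫ x, exp (p * w x) ∂μ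
  have hZ : 0 < Z := integral_exp_pos hi
  set f : EuclideanSpace ℝ (Fin n) → ℝ := fun x => exp (p / 2 * w x - log Z / 2) with hf
  have hf2 : ∀ x, f x ^ 2 = Z⁻¹ * exp (p * w x) := fun x => by
    rw [hf, ← exp_log hZ, ← exp_neg, ← exp_add, ← exp_nat_mul, exp_log hZ]
    push_cast
    ring_nf
  have hlogf : ∀ x, log (f x ^ 2) = p * w x - log Z := fun x => by
    rw [log_pow, hf, log_exp]
    push_cast
    ring
  have hderiv : ∀ x, ‖fderiv ℝ f x‖ ^ 2 =
      p ^ 2 / 4 * Z⁻¹ * (exp (p * w x) * ‖gradient w x‖ ^ 2) := fun x => by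
    have hgn : ‖gradient w x‖ = ‖fderiv ℝ w x‖ := by rw [gradient, LinearIsometryEquiv.norm_map]
    by_cases hx : DifferentiableAt ℝ w x
    · have h1 := ((hx.hasFDerivAt.const_mul (p / 2)).sub_const (log Z / 2)).exp
      rw [h1.fderiv, norm_smul, norm_smul, mul_pow, mul_pow, hgn, norm_eq_abs, sq_abs, norm_eq_abs,
        sq_abs]
      have := hf2 x
      simp only [hf] at this
      rw [this]
      ring
    · have hfx : ¬ DifferentiableAt ℝ f x := fun h => hx <| by
        have h1 := ((h.log (exp_pos _).ne').add_const (log Z / 2)).const_mul (2 / p)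
        refine h1.congr_of_eventuallyEq (.of_forall fun y => ?_)
        simp only [hf, log_exp]
        field_simp
        ring
      rw [hgn, fderiv_zero_of_not_differentiableAt hx, fderiv_zero_of_not_differentiableAt hfx]
      simp
  have hlip : LocallyLipschitz f := by
    have h1 : LocallyLipschitz fun y : ℝ => exp (p / 2 * y - log Z / 2) :=
      ContDiff.locallyLipschitz (𝕂 := ℝ) (by fun_prop)
    exact h1.comp hK.locallyLipschitz
  have key := hLS f hlip (by simp only [hderiv]; exact hig.const_mul _) (by
    simp only [hf2]
    rw [integral_const_mul, inv_mul_cancel₀ hZ.ne'])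
  simp only [hlogf, hderiv] at key
  rw [integral_const_mul] at key
  have h1 : ∫ x, f x ^ 2 * (p * w x - log Z) ∂μ =
      Z⁻¹ * (∫ x, exp (p * w x) * (p * w x) ∂μ - Z * log Z) := by
    have h2 : ∀ x, f x ^ 2 * (p * w x - log Z) =
        Z⁻¹ * (exp (p * w x) * (p * w x) - exp (p * w x) * log Z) := fun x => by
      rw [hf2]
      ring
    simp only [h2]
    rw [integral_const_mul, integral_sub hiw (hi.mul_const _), integral_mul_const]
  rw [h1, inv_mul_le_iff₀ hZ] at key
  refine key.trans_eq ?_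
  field_simp
  ring

/-- The Bobkov–Gentil–Ledoux theorem: a logarithmic Sobolev inequality implies hypercontractivity
of the Hopf–Lax semigroup. -/
lemma LogSobolevIneq.hopfLax_hypercontractive [IsProbabilityMeasure μ] {C : ℝ} (hC : 0 < C)
    (hLS : LogSobolevIneq μ C) {f : EuclideanSpace ℝ (Fin n) → ℝ} (hK : LipschitzWith K f)
    (hM : ∀ x, |f x| ≤ M) {s : ℝ} (hs : 0 ≤ s) :
    log (∫ x, exp ((1 + s / C) * hopfLax f s x) ∂μ) / (1 + s / C) ≤ log (∫ x, exp (f x) ∂μ) := by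
  set A : ℝ → ℝ := fun t => log (∫ x, exp ((1 + t / C) * hopfLax f t x) ∂μ) / (1 + t / C) with hA
  have hM0 : 0 ≤ M := (abs_nonneg _).trans (hM 0)
  have hp : ∀ t : ℝ, 0 ≤ t → 0 < 1 + t / C := fun t ht => by positivity
  have hQm : ∀ t, 0 ≤ t → Measurable (hopfLax f t) := fun t ht =>
    (lipschitzWith_hopfLax hK hM ht).continuous.measurable
  have hQb : ∀ t, 0 ≤ t → ∀ x, |(1 + t / C) * hopfLax f t x| ≤ (1 + t / C) * M := by
    intro t ht x
    rw [abs_mul, abs_of_pos (hp t ht)]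
    exact mul_le_mul_of_nonneg_left (abs_hopfLax_le hM ht x) (hp t ht).le
  have hi : ∀ t, 0 ≤ t → Integrable (fun x => exp ((1 + t / C) * hopfLax f t x)) μ :=
    fun t ht => integrable_exp_of_abs_le_const ((hQm t ht).const_mul _) (hQb t ht)
  have hcont : ContinuousOn A (Set.Icc 0 s) := by
    have h1 : ContinuousOn (fun t => ∫ x, exp ((1 + t / C) * hopfLax f t x) ∂μ) (Set.Icc 0 s) := by
      refine continuousOn_of_dominated (bound := fun _ => exp ((1 + s / C) * M))
        (fun t ht => (hi t ht.1).aestronglyMeasurable) (fun t ht => .of_forall fun x => ?_)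
        (integrable_const _) (.of_forall fun x => ?_)
      · rw [norm_of_nonneg (exp_pos _).le, exp_le_exp]
        refine (le_of_abs_le (hQb t ht.1 x)).trans ?_
        have := ht.2
        gcongr
      · have := (continuousOn_hopfLax hK hM x).mono
          (Set.Icc_subset_Ici_self : Set.Icc 0 s ⊆ Set.Ici 0)
        fun_prop
    exact (h1.log fun t ht => (integral_exp_pos (hi t ht.1)).ne').div (by fun_prop)
      fun t ht => (hp t ht.1).ne'
  have hbound : ∀ t ∈ Set.Ico 0 s, ∀ r, (0 : ℝ) < r → ∃ᶠ z in 𝓝[>] t, slope A t z < r := by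
    intro t ht r hr
    have ht0 := ht.1
    set w := hopfLax f t
    set p := 1 + t / C with hpdef
    have hp0 : 0 < p := hp t ht0
    have hwK : LipschitzWith K w := lipschitzWith_hopfLax hK hM ht0
    have hwM : ∀ x, |w x| ≤ M := abs_hopfLax_le hM ht0
    have hwm := hwK.continuous.measurable
    set Z := ∫ x, exp (p * w x) ∂μ with hZdef
    have hZ : 0 < Z := integral_exp_pos (hi t ht0)
    have hζ := hasDerivAt_integral_exp_gradientStep (μ := μ) hwK hwM hp0.le (q := 1 / C)
      (by positivity)
    set D := ∫ x, exp (p * w x) * (1 / C * w x - p * (‖gradient w x‖ ^ 2 / 2)) ∂μ with hD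
    set ζ : ℝ → ℝ := fun h => ∫ x, exp ((p + 1 / C * h) * gradientStep w h x) ∂μ with hζdef
    have hζ0 : ζ 0 = Z := by simp [hζdef, gradientStep_zero, hZdef]
    set B : ℝ → ℝ := fun h => log (ζ h) / (p + 1 / C * h) with hB
    have hlin : HasDerivAt (fun h : ℝ => p + 1 / C * h) (1 / C) 0 := by
      simpa using ((hasDerivAt_id (0 : ℝ)).const_mul (1 / C)).const_add p
    have hBd : HasDerivAt B ((D / Z * p - log Z * (1 / C)) / p ^ 2) 0 := by
      have := (hζ.log (by rw [hζ0]; exact hZ.ne')).div hlin (by simpa using hp0.ne')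
      refine this.congr_deriv ?_
      rw [hζ0, mul_zero, add_zero]
    have hB0 : B 0 = A t := by simp [hB, hζ0, hA, hZdef, hpdef, w]
    have hneg : (D / Z * p - log Z * (1 / C)) / p ^ 2 ≤ 0 := by
      refine div_nonpos_of_nonpos_of_nonneg ?_ (by positivity)
      have hLSI := hLS.exp_form hwK hwM hp0
      have hei : Integrable (fun x => exp (p * w x)) μ := hi t ht0
      have hgm := measurable_gradient (w := w)
      have hiw : Integrable (fun x => exp (p * w x) * (p * w x)) μ :=
        hei.mul_bdd (c := p * M) (hwm.const_mul p).aestronglyMeasurable (.of_forall (hQb t ht0))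
      have hig : Integrable (fun x => exp (p * w x) * ‖gradient w x‖ ^ 2) μ := by
        refine hei.mul_bdd (c := K ^ 2) (by fun_prop : Measurable _).aestronglyMeasurable
          (.of_forall fun x => ?_)
        rw [norm_pow, norm_norm]
        gcongr
        exact norm_gradient_le hwK x
      have hD' : D * p = 1 / C * ∫ x, exp (p * w x) * (p * w x) ∂μ
          - p ^ 2 / 2 * ∫ x, exp (p * w x) * ‖gradient w x‖ ^ 2 ∂μ := by
        rw [hD, ← integral_mul_const, ← integral_const_mul, ← integral_const_mul,
          ← integral_sub (hiw.const_mul _) (hig.const_mul _)]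
        refine integral_congr_ae (.of_forall fun x => ?_)
        simp only
        ring
      rw [← hZdef] at hLSI
      have h1 : D / Z * p - log Z * (1 / C) = (D * p - 1 / C * (Z * log Z)) / Z := by
        field_simp
      rw [h1, hD']
      refine div_nonpos_of_nonpos_of_nonneg ?_ hZ.le
      have h2 := mul_le_mul_of_nonneg_left hLSI (by positivity : 0 ≤ 1 / C)
      have h3 : 1 / C * (C * p ^ 2 / 2 * ∫ x, exp (p * w x) * ‖gradient w x‖ ^ 2 ∂μ) =
          p ^ 2 / 2 * ∫ x, exp (p * w x) * ‖gradient w x‖ ^ 2 ∂μ := by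
        field_simp
      linarith
    have hle : ∀ h : ℝ, 0 < h → A (t + h) ≤ B h := by
      intro h hh
      have hph : p + 1 / C * h = 1 + (t + h) / C := by
        rw [hpdef]
        ring
      have hth : 0 ≤ t + h := by linarith
      simp only [hA, hB, hζdef, hph]
      refine div_le_div_of_nonneg_right ?_ (hp _ hth).le
      refine log_le_log (integral_exp_pos (hi _ hth)) ?_
      refine integral_mono (hi _ hth) ?_ fun x => ?_
      · refine integrable_exp_of_abs_le_const (M := (1 + (t + h) / C) * (M + 3 / 2 * K ^ 2 * h))
          ((measurable_gradientStep hwm h).const_mul _) fun x => ?_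
        rw [abs_mul, abs_of_pos (hp _ hth)]
        refine mul_le_mul_of_nonneg_left ?_ (hp _ hth).le
        have h1 := abs_gradientStep_sub_le hwK x h 0
        rw [gradientStep_zero, sub_zero, abs_of_pos hh] at h1
        have h4 := abs_add_le (gradientStep w h x - w x) (w x)
        rw [sub_add_cancel] at h4
        linarith [hwM x]
      · exact exp_le_exp.2 (mul_le_mul_of_nonneg_left (hopfLax_add_le hM ht0 hh x _) (hp _ hth).le)
    have hslope : ∀ᶠ h in 𝓝[>] (0 : ℝ), slope B 0 h < r :=
      ((hasDerivWithinAt_iff_tendsto_slope' (by simp)).1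
        (hBd.hasDerivWithinAt (s := Set.Ioi 0))).eventually_lt_const (hneg.trans_lt hr)
    have hmap : Tendsto (fun z => z - t) (𝓝[>] t) (𝓝[>] 0) := by
      refine tendsto_nhdsWithin_iff.2 ⟨?_, ?_⟩
      · have : Tendsto (fun z : ℝ => z - t) (𝓝 t) (𝓝 (t - t)) :=
          (continuous_id.sub continuous_const).tendsto t
        rw [sub_self] at this
        exact this.mono_left nhdsWithin_le_nhds
      · filter_upwards [self_mem_nhdsWithin] with z hz using sub_pos.2 (Set.mem_Ioi.1 hz)
    refine Eventually.frequently ?_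
    filter_upwards [hmap.eventually hslope, self_mem_nhdsWithin] with z hz hzt
    have hzt' : 0 < z - t := sub_pos.2 hzt
    refine lt_of_le_of_lt ?_ hz
    rw [slope_def_field, slope_def_field, sub_zero, hB0]
    refine div_le_div_of_nonneg_right ?_ hzt'.le
    have := hle _ hzt'
    rw [add_sub_cancel] at this
    linarith
  have := image_le_of_liminf_slope_right_le_deriv_boundary hcont (B := fun _ => A 0)
    (B' := fun _ => 0) le_rfl continuousOn_const (fun x _ => hasDerivWithinAt_const _ _ _) hbound
    (Set.right_mem_Icc.2 hs)
  simpa [hA, hopfLax_zero] using this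

end HopfLax

section Contraction

variable {n : ℕ} {μ ν : Measure (EuclideanSpace ℝ (Fin n))}

/-- Gaussian averages of `g` are dominated by the Hopf–Lax evolution of `log P_s (exp g)`. -/
lemma integral_stdGaussian_le_hopfLax {g : EuclideanSpace ℝ (Fin n) → ℝ} (hg : Measurable g)
    {M : ℝ} (hM : ∀ x, |g x| ≤ M) {s : ℝ} (hs : 0 ≤ s) (x : EuclideanSpace ℝ (Fin n)) :
    ∫ z, g (x + Real.sqrt s • z) ∂(_root_.stdGaussian n) ≤
      hopfLax (fun x => log (∫ z, exp (g (x + Real.sqrt s • z)) ∂(_root_.stdGaussian n))) s x := by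
  refine le_ciInf fun y => ?_
  have h := integral_le_log_integral_exp_add_stdGaussian
    (h := fun z => g (x + Real.sqrt s • z)) (by fun_prop) (fun z => hM _) (Real.sqrt s • y)
  have h1 : ∀ z, x + Real.sqrt s • (z + Real.sqrt s • y) = x + s • y + Real.sqrt s • z := by
    intro z
    rw [smul_add, smul_smul, mul_self_sqrt hs]
    abel
  simpa only [h1, norm_smul, mul_pow, norm_eq_abs, sq_abs, sq_sqrt hs] using h

/-- Under a log-Sobolev inequality, the Gaussian channel is hypercontractive. -/
lemma LogSobolevIneq.integral_heatFlow_le [IsProbabilityMeasure μ] [IsProbabilityMeasure ν]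
    {C : ℝ} (hC : 0 < C) (hLS : LogSobolevIneq μ C) (hνμ : ν ≪ μ)
    (hint : Integrable (fun x => log (ν.rnDeriv μ x).toReal) ν)
    {g : EuclideanSpace ℝ (Fin n) → ℝ} {K : ℝ≥0} (hg : LipschitzWith K g) {M : ℝ}
    (hM : ∀ x, |g x| ≤ M) {s : ℝ} (hs : 0 ≤ s) :
    ∫ x, g x ∂(heatFlow ν s) ≤
      klDiv ν μ / (1 + s / C) + log (∫ x, exp (g x) ∂(heatFlow μ s)) := by
  set p : ℝ := 1 + s / C
  have hp : 0 < p := by positivity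
  have hgm : Measurable g := hg.continuous.measurable
  set P : EuclideanSpace ℝ (Fin n) → ℝ :=
    fun x => ∫ z, g (x + Real.sqrt s • z) ∂(_root_.stdGaussian n) with hP
  set f : EuclideanSpace ℝ (Fin n) → ℝ :=
    fun x => log (∫ z, exp (g (x + Real.sqrt s • z)) ∂(_root_.stdGaussian n)) with hf
  have hgz : ∀ x, Measurable fun z => g (x + Real.sqrt s • z) := fun x => by fun_prop
  have hfK : LipschitzWith K f := lipschitzWith_log_integral_exp hg hM _
  have hfM : ∀ x, |f x| ≤ M := fun x => abs_log_integral_exp_le (hgz x) fun z => hM _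
  have hPm : Measurable P := by
    have : StronglyMeasurable (Function.uncurry fun x z => g (x + Real.sqrt s • z)) :=
      (hgm.comp (measurable_heatFlow_map s)).stronglyMeasurable
    exact this.integral_prod_right.measurable
  have hPM : ∀ x, |P x| ≤ M := fun x => by
    simpa using norm_integral_le_of_norm_le_const (μ := _root_.stdGaussian n)
      (f := fun z => g (x + Real.sqrt s • z)) (.of_forall fun z => hM _)
  have hpPM : ∀ x, |p * P x| ≤ p * M := fun x => by
    rw [abs_mul, abs_of_pos hp]
    exact mul_le_mul_of_nonneg_left (hPM x) hp.le
  have hpQM : ∀ x, |p * hopfLax f s x| ≤ p * M := fun x => by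
    rw [abs_mul, abs_of_pos hp]
    exact mul_le_mul_of_nonneg_left (abs_hopfLax_le hfM hs x) hp.le
  have hQm : Measurable (hopfLax f s) := (lipschitzWith_hopfLax hfK hfM hs).continuous.measurable
  have hexpf : ∫ x, exp (g x) ∂(heatFlow μ s) = ∫ x, exp (f x) ∂μ := by
    rw [integral_heatFlow μ s hgm.exp (M := exp M) fun x => by
      rw [abs_of_pos (exp_pos _)]
      exact exp_le_exp.2 (le_of_abs_le (hM x))]
    refine integral_congr_ae (.of_forall fun x => (exp_log ?_).symm)
    exact integral_exp_pos (integrable_exp_of_abs_le_const (hgz x) fun z => hM _)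
  have h1 := integral_le_klDiv_add_log_integral_exp hνμ hint (hPm.const_mul p) hpPM
  have h2 : log (∫ x, exp (p * P x) ∂μ) ≤ log (∫ x, exp (p * hopfLax f s x) ∂μ) := by
    have hi : Integrable (fun x => exp (p * P x)) μ :=
      integrable_exp_of_abs_le_const (hPm.const_mul p) hpPM
    refine log_le_log (integral_exp_pos hi) (integral_mono hi
      (integrable_exp_of_abs_le_const (hQm.const_mul p) hpQM) fun x => exp_le_exp.2 ?_)
    exact mul_le_mul_of_nonneg_left (integral_stdGaussian_le_hopfLax hgm hM hs x) hp.le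
  have h3 := hLS.hopfLax_hypercontractive hC hfK hfM hs
  rw [div_le_iff₀ hp] at h3
  rw [integral_const_mul] at h1
  rw [integral_heatFlow ν s hgm hM, hexpf, ← sub_le_iff_le_add, le_div_iff₀ hp]
  linarith

lemma LogSobolevIneq.klDiv_heatFlow_le [IsProbabilityMeasure μ] [IsProbabilityMeasure ν]
    {C : ℝ} (hC : 0 < C) (hLS : LogSobolevIneq μ C) (hνμ : ν ≪ μ)
    (hint : Integrable (fun x => log (ν.rnDeriv μ x).toReal) ν) {s : ℝ} (hs : 0 ≤ s) :
    klDiv (heatFlow ν s) (heatFlow μ s) ≤ klDiv ν μ / (1 + s / C) := by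
  by_cases hi : Integrable
      (fun x => log ((heatFlow ν s).rnDeriv (heatFlow μ s) x).toReal) (heatFlow ν s)
  · exact klDiv_le_of_forall_lipschitz (heatFlow_absolutelyContinuous hνμ s) hi
      fun u M K hu hM => hLS.integral_heatFlow_le hC hνμ hint hu hM hs
  · rw [klDiv, integral_undef hi]
    exact div_nonneg (klDiv_nonneg hνμ) (by positivity)

end Contraction

/-- If `μ` has fourth moment and satisfies the log-Sobolev inequality with
constant `C`, then `D(ν_s‖μ_s) ≤ D(ν‖μ)/(1 + s/C)`; in particular
`η_KL(μ,s) ≤ 1/(1 + s/C)`. -/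
theorem stmt14 {n : ℕ} (μ : Measure (EuclideanSpace ℝ (Fin n))) [IsProbabilityMeasure μ]
    (hmom : Integrable (fun x => ‖x‖ ^ 4) μ)
    (C : ℝ) (hC : 0 < C) (hLS : LogSobolevIneq μ C) :
    (∀ ν : Measure (EuclideanSpace ℝ (Fin n)), IsProbabilityMeasure ν → ν ≪ μ →
      Integrable (fun x => Real.log (ν.rnDeriv μ x).toReal) ν →
      ∀ s : ℝ, 0 < s →
        klDiv (heatFlow ν s) (heatFlow μ s) ≤ klDiv ν μ / (1 + s / C)) ∧
    ∀ s : ℝ, 0 < s → etaKL μ s ≤ 1 / (1 + s / C) := by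
  have key : ∀ ν : Measure (EuclideanSpace ℝ (Fin n)), IsProbabilityMeasure ν → ν ≪ μ →
      Integrable (fun x => Real.log (ν.rnDeriv μ x).toReal) ν →
      ∀ s : ℝ, 0 < s →
        klDiv (heatFlow ν s) (heatFlow μ s) ≤ klDiv ν μ / (1 + s / C) :=
    fun ν _ hνμ hint s hs => hLS.klDiv_heatFlow_le hC hνμ hint hs.le
  refine ⟨key, fun s hs => Real.sSup_le ?_ (by positivity)⟩
  rintro r ⟨ν, hν, hνμ, hint, hpos, rfl⟩
  rw [div_le_iff₀ hpos, one_div_mul_eq_div]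
  exact key ν hν hνμ hint s hs
end
end
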